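/- arXiv:1612.05043 — 3 statements merged into one kernel-verified Lean document; each statement's English description precedes it below -/
import Mathlib

section
/- Let G^σ be an oriented graph with sr(G^σ) = r(G) − 2d(G), and let x be a vertex lying on a cycle of G. Then sr(G^σ) = sr(G^σ − x), r(G) = r(G − x) + 2, and d(G) = d(G − x) + 1. -/
open scoped Classical

def IsSkewAdjMatrix {V : Type*} (G : SimpleGraph V) (S : Matrix V V ℝ) : Prop :=
  (∀ i j, G.Adj i j → S i j = 1 ∨ S i j = -1) ∧
  (∀ i j, ¬ G.Adj i j → S i j = 0) ∧
  (∀ i j, S j i = - S i j)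

noncomputable def adjMat {V : Type*} (G : SimpleGraph V) : Matrix V V ℝ :=
  Matrix.of fun i j => if G.Adj i j then 1 else 0

noncomputable def cycDim {V : Type*} (G : SimpleGraph V) : ℤ :=
  (G.edgeSet.ncard : ℤ) - Nat.card V + Nat.card G.ConnectedComponent

def OnCycle {V : Type*} (G : SimpleGraph V) (x : V) : Prop :=
  ∃ (u : V) (w : G.Walk u u), w.IsCycle ∧ x ∈ w.support

lemma rank_rows_le {V W U : Type*} [Fintype V] [Fintype W] [Fintype U] (A : Matrix V U ℝ) (x : V) (g : W → V)
    (hg : ∀ v, v ≠ x → ∃ w, g w = v) : A.rank ≤ (A.submatrix g id).rank + 1 := by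
  rw [Matrix.rank_eq_finrank_span_row, Matrix.rank_eq_finrank_span_row]
  have h : Set.range A.row ⊆ insert (A.row x) (Set.range (A.submatrix g id).row) := by
    rintro _ ⟨v, rfl⟩
    by_cases hv : v = x
    · left; rw [hv]
    · obtain ⟨w, rfl⟩ := hg v hv
      right; exact ⟨w, rfl⟩
  have h1 := Submodule.finrank_mono (Submodule.span_mono (R := ℝ) h)
  rw [Submodule.span_insert] at h1
  have h2 := Submodule.finrank_add_le_finrank_add_finrank (Submodule.span ℝ {A.row x})
    (Submodule.span ℝ (Set.range (A.submatrix g id).row))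
  have h3 := finrank_span_le_card (R := ℝ) ({A.row x} : Set (U → ℝ))
  simp at h3
  omega

lemma rank_le_delete {V W : Type*} [Fintype V] [Fintype W] (A : Matrix V V ℝ) (x : V) (g : W → V)
    (hg : ∀ v, v ≠ x → ∃ w, g w = v) : A.rank ≤ (A.submatrix g g).rank + 2 := by
  have h1 := rank_rows_le A x g hg
  have h2 := rank_rows_le (A.submatrix g id).transpose x g hg
  have h3 : (A.submatrix g id).transpose.submatrix g id = (A.submatrix g g).transpose := rfl
  rw [h3, Matrix.rank_transpose, Matrix.rank_transpose] at h2
  omega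

lemma skew_sub {V W : Type*} {G : SimpleGraph V} {S : Matrix V V ℝ} (hS : IsSkewAdjMatrix G S)
    (g : W → V) : IsSkewAdjMatrix (G.comap g) (S.submatrix g g) :=
  ⟨fun i j h => hS.1 _ _ h, fun i j h => hS.2.1 _ _ h, fun i j => hS.2.2 _ _⟩

lemma adj_sub {V W : Type*} (G : SimpleGraph V)
    (g : W → V) : adjMat (G.comap g) = (adjMat G).submatrix g g := by
  ext i j; simp [adjMat]

/-- signs on a forest -/
lemma forest_signs : ∀ (n : ℕ) {V : Type*} [Fintype V] (G : SimpleGraph V) (S : Matrix V V ℝ),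
    Fintype.card V = n → IsSkewAdjMatrix G S → G.IsAcyclic →
    ∃ e f : V → ℝ, (∀ i, e i * e i = 1) ∧ (∀ i, f i * f i = 1) ∧
      ∀ i j, adjMat G i j = e i * S i j * f j := by
  intro n
  induction n with
  | zero =>
    intro V _ G S hc _ _
    have := Fintype.card_eq_zero_iff.mp hc
    exact ⟨fun _ => 1, fun _ => 1, fun i => isEmptyElim i, fun i => isEmptyElim i,
      fun i => isEmptyElim i⟩
  | succ n ih =>
    intro V _ G S hc hS hG
    have hne : Nonempty V := Fintype.card_pos_iff.mp (by omega)
    obtain ⟨x, v, p, hp, hmax⟩ := SimpleGraph.Walk.exists_isPath_forall_isPath_length_le_length G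
    have hleaf : ∀ w, G.Adj x w → w = p.snd := by
      intro w hw
      refine hG.eq_snd_of_adj_start hp hw ?_
      by_contra hns
      have := hmax _ _ (SimpleGraph.Walk.cons hw.symm p) (hp.cons hns)
      simp at this
    generalize p.snd = y at hleaf
    obtain ⟨e, f, he, hf, hef⟩ := ih (V := ({x}ᶜ : Set V)) (G.comap Subtype.val)
      (S.submatrix Subtype.val Subtype.val)
      (by rw [Fintype.card_compl_set]; simp [hc]) (skew_sub hS _) (hG.induce _)
    by_cases hxy : G.Adj x y
    · have hyx : y ∈ ({x}ᶜ : Set V) := by simpa using hxy.ne'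
      refine ⟨fun i => if h : i ∈ ({x}ᶜ : Set V) then e ⟨i, h⟩ else S x y * f ⟨y, hyx⟩,
        fun i => if h : i ∈ ({x}ᶜ : Set V) then f ⟨i, h⟩ else S y x * e ⟨y, hyx⟩, ?_, ?_, ?_⟩
      · intro i
        dsimp only
        split_ifs with h
        · exact he _
        · have := hf ⟨y, hyx⟩
          rcases hS.1 x y hxy with h | h <;> rw [h] <;> linarith
      · intro i
        dsimp only
        split_ifs with h
        · exact hf _
        · have := he ⟨y, hyx⟩
          rcases hS.1 y x hxy.symm with h | h <;> rw [h] <;> linarith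
      · intro i j
        dsimp only
        by_cases hij : G.Adj i j
        · have hA : adjMat G i j = 1 := by simp [adjMat, hij]
          rw [hA]
          by_cases hi : i = x
          · subst hi
            obtain rfl := hleaf j hij
            rw [dif_neg (by simp), dif_pos hyx]
            have := hf ⟨j, hyx⟩
            rcases hS.1 i j hij with h | h <;> rw [h] <;> linarith
          · by_cases hj : j = x
            · subst hj
              obtain rfl := hleaf i hij.symm
              rw [dif_pos hyx, dif_neg (by simp)]
              have := he ⟨i, hyx⟩
              rcases hS.1 i j hij with h | h <;> rw [h] <;> linarith
            · rw [dif_pos (by simpa using hi), dif_pos (by simpa using hj)]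
              rw [← hA]
              have := hef ⟨i, by simpa using hi⟩ ⟨j, by simpa using hj⟩
              rw [adj_sub] at this
              exact this
        · rw [hS.2.1 _ _ hij]; simp [adjMat, hij]
    · have hno : ∀ w, ¬ G.Adj x w := fun w hw => hxy (hleaf w hw ▸ hw)
      refine ⟨fun i => if h : i ∈ ({x}ᶜ : Set V) then e ⟨i, h⟩ else 1,
        fun i => if h : i ∈ ({x}ᶜ : Set V) then f ⟨i, h⟩ else 1, ?_, ?_, ?_⟩
      · intro i
        dsimp only
        split_ifs with h
        · exact he _
        · simp
      · intro i
        dsimp only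
        split_ifs with h
        · exact hf _
        · simp
      · intro i j
        dsimp only
        by_cases hij : G.Adj i j
        · have hi : i ≠ x := by rintro rfl; exact hno _ hij
          have hj : j ≠ x := by rintro rfl; exact hno _ hij.symm
          rw [dif_pos (by simpa using hi), dif_pos (by simpa using hj)]
          have := hef ⟨i, by simpa using hi⟩ ⟨j, by simpa using hj⟩
          rw [adj_sub] at this
          exact this
        · rw [hS.2.1 _ _ hij]; simp [adjMat, hij]

lemma forest_rank {V : Type*} [Fintype V] (G : SimpleGraph V) (S : Matrix V V ℝ)
    (hS : IsSkewAdjMatrix G S) (hG : G.IsAcyclic) : (adjMat G).rank ≤ S.rank := by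
  obtain ⟨e, f, -, -, h⟩ := forest_signs _ G S rfl hS hG
  have : adjMat G = Matrix.diagonal e * S * Matrix.diagonal f := by
    ext i j
    rw [h, Matrix.mul_diagonal, Matrix.diagonal_mul]
  rw [this]
  exact (Matrix.rank_mul_le_left _ _).trans (Matrix.rank_mul_le_right _ _)

lemma cycle_nbrs {V : Type*} (G : SimpleGraph V) (x : V) (hx : OnCycle G x) :
    ∃ (u v : V) (hu : u ∈ ({x}ᶜ : Set V)) (hv : v ∈ ({x}ᶜ : Set V)), u ≠ v ∧ G.Adj x u ∧
      G.Adj x v ∧ (G.induce ({x}ᶜ : Set V)).Reachable ⟨u, hu⟩ ⟨v, hv⟩ := by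
  obtain ⟨a, w, hw, hxw⟩ := hx
  have hc := hw.rotate hxw
  generalize w.rotate x hxw = c at hc
  cases c with
  | nil => exact absurd rfl hc.ne_nil
  | @cons _ u _ h p =>
    rw [SimpleGraph.Walk.cons_isCycle_iff] at hc
    obtain ⟨hp, he⟩ := hc
    rw [← SimpleGraph.Walk.isPath_reverse_iff] at hp
    have he' : s(x, u) ∉ p.reverse.edges := by simpa using he
    generalize p.reverse = q at hp he'
    cases q with
    | nil => exact absurd h (G.irrefl)
    | @cons _ v _ h' q =>
      rw [SimpleGraph.Walk.cons_isPath_iff] at hp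
      refine ⟨v, u, by simpa using h'.ne', by simpa using h.ne', ?_, h', h, ?_⟩
      · rintro rfl; simp at he'
      · exact ⟨q.induce _ (fun y hy => by rintro rfl; exact hp.2 hy)⟩

lemma stay {V : Type*} (G : SimpleGraph V) (x : V) {c d : V} (p : G.Walk c d) :
    ∀ (hc : c ∈ ({x}ᶜ : Set V)),
    (∀ y (hy : y ∈ ({x}ᶜ : Set V)), G.Adj x y →
      ¬ (G.induce ({x}ᶜ : Set V)).Reachable ⟨c, hc⟩ ⟨y, hy⟩) →
    ∃ hd : d ∈ ({x}ᶜ : Set V), (G.induce ({x}ᶜ : Set V)).Reachable ⟨c, hc⟩ ⟨d, hd⟩ := by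
  induction p with
  | nil => intro hc _; exact ⟨hc, .refl _⟩
  | @cons a b d h p ih =>
    intro hc hB
    have hb : b ∈ ({x}ᶜ : Set V) := by
      rintro rfl
      exact hB a hc h.symm (.refl _)
    have hab : (G.induce ({x}ᶜ : Set V)).Reachable ⟨a, hc⟩ ⟨b, hb⟩ :=
      SimpleGraph.Adj.reachable (by simpa using h)
    obtain ⟨hd, hr⟩ := ih hb (fun y hy hxy hr => hB y hy hxy (hab.trans hr))
    exact ⟨hd, hab.trans hr⟩

/-- If every neighbour of `x` is connected in `G - x` to a member of `N`, then
`c(G-x) + 1 ≤ c(G) + |N|`. -/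
lemma comp_count {V : Type*} [Fintype V] (G : SimpleGraph V) (x : V)
    (N : Finset ({x}ᶜ : Set V))
    (hN : ∀ y : ({x}ᶜ : Set V), G.Adj x y → ∃ z ∈ N, (G.induce ({x}ᶜ : Set V)).Reachable y z) :
    Nat.card (G.induce ({x}ᶜ : Set V)).ConnectedComponent + 1 ≤
      Nat.card G.ConnectedComponent + N.card := by
  set H := G.induce ({x}ᶜ : Set V) with hH
  let A : Set H.ConnectedComponent := H.connectedComponentMk '' (N : Set ({x}ᶜ : Set V))
  let φ : H.ConnectedComponent → G.ConnectedComponent :=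
    SimpleGraph.ConnectedComponent.map (SimpleGraph.Embedding.induce ({x}ᶜ : Set V)).toHom
  have hA : A.ncard ≤ N.card := by
    refine (Set.ncard_image_le (Finset.finite_toSet N)).trans ?_
    rw [Set.ncard_coe_finset]
  have key : ∀ c : ({x}ᶜ : Set V), H.connectedComponentMk c ∈ Aᶜ → ∀ d, G.Reachable c d →
      ∃ hd : d ∈ ({x}ᶜ : Set V), H.Reachable c ⟨d, hd⟩ := by
    rintro c hc d ⟨p⟩
    refine stay G x p c.2 ?_
    intro y hy hxy hr
    obtain ⟨z, hz, hyz⟩ := hN ⟨y, hy⟩ hxy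
    exact hc ⟨z, hz, SimpleGraph.ConnectedComponent.sound (hr.trans hyz).symm⟩
  have hB : Aᶜ.ncard ≤ ({G.connectedComponentMk x}ᶜ : Set G.ConnectedComponent).ncard := by
    refine Set.ncard_le_ncard_of_injOn φ ?_ ?_ (Set.toFinite _)
    · intro C
      induction C using SimpleGraph.ConnectedComponent.ind with | _ c
      intro hC h
      obtain ⟨hd, -⟩ := key c hC x (SimpleGraph.ConnectedComponent.exact h)
      exact hd rfl
    · intro C hC D hD h
      induction C using SimpleGraph.ConnectedComponent.ind with | _ c
      induction D using SimpleGraph.ConnectedComponent.ind with | _ d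
      obtain ⟨hd, hr⟩ := key c hC d (SimpleGraph.ConnectedComponent.exact h)
      exact SimpleGraph.ConnectedComponent.sound hr
  have h1 := Set.ncard_add_ncard_compl A
  have h2 := Set.ncard_add_ncard_compl ({G.connectedComponentMk x} : Set G.ConnectedComponent)
  rw [Set.ncard_singleton] at h2
  omega

lemma cycDim_delete {V : Type*} [Fintype V] (G : SimpleGraph V) (x : V)
    (N : Finset ({x}ᶜ : Set V))
    (hN : ∀ y : ({x}ᶜ : Set V), G.Adj x y → ∃ z ∈ N, (G.induce ({x}ᶜ : Set V)).Reachable y z) :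
    cycDim (G.induce ({x}ᶜ : Set V)) + G.degree x ≤ cycDim G + N.card := by
  have h1 := comp_count G x N hN
  have h2 := G.card_edgeFinset_induce_compl_singleton x
  rw [G.card_edgeFinset_deleteIncidenceSet x] at h2
  have h3 : G.degree x ≤ G.edgeFinset.card := by
    rw [← SimpleGraph.card_incidenceFinset_eq_degree]
    exact Finset.card_le_card (G.incidenceFinset_subset x)
  have h4 : Nat.card ({x}ᶜ : Set V) + 1 = Nat.card V := by
    have := Set.ncard_add_ncard_compl ({x} : Set V)
    rw [Set.ncard_singleton] at this
    change Set.ncard _ + 1 = _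
    omega
  rw [← Set.ncard_coe_finset, SimpleGraph.coe_edgeFinset,
    ← Set.ncard_coe_finset, SimpleGraph.coe_edgeFinset] at h2
  rw [← Set.ncard_coe_finset, SimpleGraph.coe_edgeFinset] at h3
  unfold cycDim
  omega

/-- neighbours of `x` as vertices of `G - x` -/
noncomputable def nbrs {V : Type*} [Fintype V] (G : SimpleGraph V) (x : V) :
    Finset ({x}ᶜ : Set V) := Finset.univ.filter fun y => G.Adj x y

lemma nbrs_card {V : Type*} [Fintype V] (G : SimpleGraph V) (x : V) :
    (nbrs G x).card = G.degree x := by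
  rw [← SimpleGraph.card_neighborFinset_eq_degree, ← Finset.card_map (Function.Embedding.subtype _)]
  congr 1
  ext y
  simp only [nbrs, Finset.mem_map, Finset.mem_filter, Finset.mem_univ, true_and,
    SimpleGraph.mem_neighborFinset]
  constructor
  · rintro ⟨a, ha, rfl⟩; exact ha
  · intro h; exact ⟨⟨y, by simpa using h.ne'⟩, h, rfl⟩

lemma cycDim_delete_le {V : Type*} [Fintype V] (G : SimpleGraph V) (x : V) :
    cycDim (G.induce ({x}ᶜ : Set V)) ≤ cycDim G := by
  have := cycDim_delete G x (nbrs G x) (fun y hy => ⟨y, by simp [nbrs, hy], .refl _⟩)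
  rw [nbrs_card] at this
  omega

lemma cycDim_delete_lt {V : Type*} [Fintype V] (G : SimpleGraph V) (x : V) (hx : OnCycle G x) :
    cycDim (G.induce ({x}ᶜ : Set V)) + 1 ≤ cycDim G := by
  obtain ⟨u, v, hu, hv, huv, hxu, hxv, hr⟩ := cycle_nbrs G x hx
  have := cycDim_delete G x ((nbrs G x).erase ⟨u, hu⟩) (fun y hy => by
    by_cases h : y = ⟨u, hu⟩
    · subst h
      exact ⟨⟨v, hv⟩, by simp [nbrs, hxv, huv.symm], hr⟩
    · exact ⟨y, by simp [nbrs, hy, h], .refl _⟩)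
  have hm : (⟨u, hu⟩ : ({x}ᶜ : Set V)) ∈ nbrs G x := by simp [nbrs, hxu]
  have h1 := Finset.card_erase_add_one hm
  rw [nbrs_card] at h1
  omega

lemma cycDim_nonneg : ∀ (n : ℕ) {V : Type*} [Fintype V] (G : SimpleGraph V),
    Fintype.card V = n → 0 ≤ cycDim G := by
  intro n
  induction n with
  | zero =>
    intro V _ G hc
    unfold cycDim
    rw [Nat.card_eq_fintype_card, hc]
    omega
  | succ n ih =>
    intro V _ G hc
    obtain ⟨x⟩ : Nonempty V := Fintype.card_pos_iff.mp (by omega)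
    exact (ih (V := ({x}ᶜ : Set V)) _ (by rw [Fintype.card_compl_set]; simp [hc])).trans
      (cycDim_delete_le G x)

lemma main_ineq : ∀ (n : ℕ) {V : Type*} [Fintype V] (G : SimpleGraph V) (S : Matrix V V ℝ),
    Fintype.card V = n → IsSkewAdjMatrix G S →
    ((adjMat G).rank : ℤ) - 2 * cycDim G ≤ (S.rank : ℤ) := by
  intro n
  induction n with
  | zero =>
    intro V _ G S hc hS
    have h1 := cycDim_nonneg _ G rfl
    have h2 := (adjMat G).rank_le_card_height
    omega
  | succ n ih =>
    intro V _ G S hc hS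
    by_cases h : ∃ x, OnCycle G x
    · obtain ⟨x, hx⟩ := h
      have h1 := cycDim_delete_lt G x hx
      have h2 := ih (V := ({x}ᶜ : Set V)) (G.induce ({x}ᶜ : Set V))
        (S.submatrix Subtype.val Subtype.val)
        (by rw [Fintype.card_compl_set]; simp [hc]) (skew_sub hS _)
      have h3 := S.rank_submatrix_le (Subtype.val : ({x}ᶜ : Set V) → V)
        (Subtype.val : ({x}ᶜ : Set V) → V)
      have h4 := rank_le_delete (adjMat G) x (Subtype.val : ({x}ᶜ : Set V) → V)
        (fun v hv => ⟨⟨v, by simpa using hv⟩, rfl⟩)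
      have h5 := adj_sub G (Subtype.val : ({x}ᶜ : Set V) → V)
      rw [← h5] at h4
      change (((adjMat (G.comap (Subtype.val : ({x}ᶜ : Set V) → V))).rank : ℕ) : ℤ) - _ ≤ _ at h2
      omega
    · have hG : G.IsAcyclic := fun u w hw => h ⟨u, u, w, hw, w.start_mem_support⟩
      have h1 := cycDim_nonneg _ G rfl
      have h2 := forest_rank G S hS hG
      omega

/-- If G^σ is lower-optimal (sr = r - 2d) and x lies on a cycle of G, then
sr(G^σ) = sr(G^σ - x), r(G) = r(G - x) + 2 and d(G) = d(G - x) + 1. -/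
theorem lowerOptimal_delete_cycle_vertex {V : Type*} [Fintype V] [DecidableEq V]
    (G : SimpleGraph V) (S : Matrix V V ℝ) (hS : IsSkewAdjMatrix G S)
    (hlo : (S.rank : ℤ) = ((adjMat G).rank : ℤ) - 2 * cycDim G)
    (x : V) (hx : OnCycle G x) :
    S.rank = (S.submatrix (fun w : ({x}ᶜ : Finset V) => (w : V))
        (fun w : ({x}ᶜ : Finset V) => (w : V))).rank ∧
    (adjMat G).rank =
      ((adjMat G).submatrix (fun w : ({x}ᶜ : Finset V) => (w : V))
        (fun w : ({x}ᶜ : Finset V) => (w : V))).rank + 2 ∧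
    cycDim G = cycDim (G.induce (↑({x}ᶜ : Finset V) : Set V)) + 1 := by
  have hset : (↑({x}ᶜ : Finset V) : Set V) = {x}ᶜ := by simp
  have h1 : cycDim (G.induce (↑({x}ᶜ : Finset V) : Set V)) + 1 ≤ cycDim G := by
    rw [hset]
    exact cycDim_delete_lt G x hx
  have h2 := main_ineq _ (V := ({x}ᶜ : Finset V)) (G.comap fun w : ({x}ᶜ : Finset V) => (w : V))
    (S.submatrix (fun w : ({x}ᶜ : Finset V) => (w : V)) (fun w : ({x}ᶜ : Finset V) => (w : V)))
    rfl (skew_sub hS _)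
  rw [adj_sub] at h2
  change _ - 2 * cycDim (G.induce (↑({x}ᶜ : Finset V) : Set V)) ≤ _ at h2
  have h3 := S.rank_submatrix_le (fun w : ({x}ᶜ : Finset V) => (w : V))
    (fun w : ({x}ᶜ : Finset V) => (w : V))
  have h4 := rank_le_delete (adjMat G) x (fun w : ({x}ᶜ : Finset V) => (w : V))
    (fun v hv => ⟨⟨v, by simpa using hv⟩, rfl⟩)
  refine ⟨?_, ?_, ?_⟩ <;> omega
end

section
/- Let G^σ be a lower-optimal oriented graph with a pendant vertex y adjacent to x, and let H^σ = G^σ − x − y. Then x lies on no cycle of G and H^σ is also lower-optimal, i.e., sr(H^σ) = r(H) − 2d(H). -/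
open scoped Classical

/-! ### Graph part -/

lemma aux_walk {V W : Type*} {G : SimpleGraph V} {H : SimpleGraph W} {f : W → V} {x : V}
    (hr : ∀ v, v ≠ x → ∃ w, f w = v) (hH : ∀ a b, H.Adj a b ↔ G.Adj (f a) (f b))
    {u v : V} (p : G.Walk u v) (a : W) (ha : f a = u)
    (hN : ∀ c, H.Reachable a c → ¬ G.Adj x (f c)) :
    ∃ b, f b = v ∧ H.Reachable a b := by
  induction p generalizing a with
  | nil => exact ⟨a, ha, .refl _⟩
  | @cons u v w h p ih =>
    subst ha
    have hv : v ≠ x := by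
      rintro rfl
      exact hN a (.refl _) h.symm
    obtain ⟨c, rfl⟩ := hr v hv
    have hac : H.Adj a c := (hH _ _).2 h
    obtain ⟨b, hb, hcb⟩ := ih c rfl (fun d hd => hN d (hac.reachable.trans hd))
    exact ⟨b, hb, hac.reachable.trans hcb⟩

lemma aux_walk_avoid {V W : Type*} {G : SimpleGraph V} {H : SimpleGraph W} {f : W → V} {x : V}
    (hf : Function.Injective f)
    (hr : ∀ v, v ≠ x → ∃ w, f w = v) (hH : ∀ a b, H.Adj a b ↔ G.Adj (f a) (f b))
    {u v : V} (p : G.Walk u v) (hx : x ∉ p.support) (a b : W) (ha : f a = u) (hb : f b = v) :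
    H.Reachable a b := by
  induction p generalizing a with
  | nil => 
    have : a = b := hf (ha.trans hb.symm)
    subst this
    exact .refl _
  | @cons u v w h p ih =>
    subst ha
    simp only [SimpleGraph.Walk.support_cons, List.mem_cons, not_or] at hx
    have hv : v ≠ x := by
      rintro rfl
      exact hx.2 p.start_mem_support
    obtain ⟨c, rfl⟩ := hr v hv
    have hac : H.Adj a c := (hH _ _).2 h
    exact hac.reachable.trans (ih hx.2 c rfl hb)

lemma aux_cycle {V W : Type*} {G : SimpleGraph V} {H : SimpleGraph W} {f : W → V} {x : V}
    (hf : Function.Injective f)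
    (hr : ∀ v, v ≠ x → ∃ w, f w = v) (hH : ∀ a b, H.Adj a b ↔ G.Adj (f a) (f b))
    (hc : OnCycle G x) :
    ∃ a b : W, a ≠ b ∧ G.Adj x (f a) ∧ G.Adj x (f b) ∧ H.Reachable a b := by
  obtain ⟨u, w, hw, hx⟩ := hc
  have hw' := hw.rotate hx
  generalize w.rotate x hx = q at hw'
  have hnil := hw'.not_nil
  have h1 := q.adj_snd hnil
  have h2 := (q.adj_penultimate hnil).symm
  have hne := hw'.snd_ne_penultimate
  obtain ⟨a, ha⟩ := hr q.snd h1.ne'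
  obtain ⟨b, hb⟩ := hr q.penultimate h2.ne'
  refine ⟨a, b, ?_, by rwa [ha], by rwa [hb], ?_⟩
  · rintro rfl
    exact hne (ha.symm.trans hb)
  have hpath : q.tail.IsPath := hw'.isPath_tail
  have hn2 : ¬ q.tail.Nil := by
    intro h
    exact h1.ne' h.eq
  have hpen : q.tail.penultimate = q.penultimate := by
    have := SimpleGraph.Walk.penultimate_cons_of_not_nil h1 q.tail hn2
    rw [SimpleGraph.Walk.cons_tail_eq _ hnil] at this
    exact this.symm
  refine aux_walk_avoid hf hr hH q.tail.dropLast ?_ a b ha (hb.trans hpen.symm)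
  intro hmem
  have hnd := hpath.support_nodup
  rw [← SimpleGraph.Walk.support_dropLast_concat hn2] at hnd
  exact (List.nodup_append.1 hnd).2.2 x hmem x (by simp) rfl

lemma cycDim_delete_s17 {V W : Type*} [Finite V] {G : SimpleGraph V} {H : SimpleGraph W}
    {f : W → V} {x : V} (hf : Function.Injective f) (hx : ∀ w, f w ≠ x)
    (hr : ∀ v, v ≠ x → ∃ w, f w = v) (hH : ∀ a b, H.Adj a b ↔ G.Adj (f a) (f b)) :
    cycDim H ≤ cycDim G ∧ (OnCycle G x → cycDim H + 1 ≤ cycDim G) := by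
  have : Finite W := Finite.of_injective f hf
  have hV : Nat.card V = Nat.card W + 1 := by
    have e : V ≃ Option W := by
      refine (Equiv.ofBijective (fun o : Option W => o.elim x f) ⟨?_, ?_⟩).symm
      · rintro (_ | a) (_ | b) h
        · rfl
        · exact absurd h.symm (hx b)
        · exact absurd h (hx a)
        · exact congrArg some (hf h)
      · intro v
        by_cases hv : v = x
        · exact ⟨none, hv.symm⟩
        · obtain ⟨w, hw⟩ := hr v hv
          exact ⟨some w, hw⟩
    rw [Nat.card_congr e, Finite.card_option]
  set N : Set W := {c | G.Adj x (f c)} with hN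
  have hE : H.edgeSet.ncard + N.ncard ≤ G.edgeSet.ncard := by
    have h1 : (Sym2.map f '' H.edgeSet).ncard = H.edgeSet.ncard :=
      Set.ncard_image_of_injective _ (Sym2.map.injective hf)
    have h2 : ((fun c => s(x, f c)) '' N).ncard = N.ncard := by
      apply Set.ncard_image_of_injective
      intro a b hab
      simp only [Sym2.eq_iff] at hab
      rcases hab with h | h
      · exact hf h.2
      · exact absurd h.1.symm (hx b)
    rw [← h1, ← h2, ← Set.ncard_union_eq]
    · apply Set.ncard_le_ncard _ (Set.toFinite _)
      rintro e (⟨e, he, rfl⟩ | ⟨c, hc, rfl⟩)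
      · induction e with
        | _ a b => exact (hH a b).1 he
      · exact hc
    · rw [Set.disjoint_left]
      rintro e ⟨e, he, rfl⟩ ⟨c, hc, h⟩
      induction e with
      | _ a b =>
        simp only [Sym2.map_mk, Sym2.eq_iff] at h
        rcases h with h | h
        · exact hx a h.1.symm
        · exact hx b h.1.symm
  set T : Set H.ConnectedComponent := H.connectedComponentMk '' N with hT
  have hfh : ∀ a b, H.Reachable a b → G.Reachable (f a) (f b) := fun a b h =>
    h.map (⟨f, fun {a b} h => (hH a b).1 h⟩ : H →g G)
  let φ : H.ConnectedComponent → G.ConnectedComponent :=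
    SimpleGraph.ConnectedComponent.map (⟨f, fun {a b} h => (hH a b).1 h⟩ : H →g G)
  have hno : ∀ a, H.connectedComponentMk a ∉ T → ∀ c, H.Reachable a c → ¬ G.Adj x (f c) := by
    intro a ha c hac hadj
    exact ha ⟨c, hadj, (SimpleGraph.ConnectedComponent.eq.2 hac.symm)⟩
  have hinj : Set.InjOn φ Tᶜ := by
    intro A hA B hB hAB
    induction A using SimpleGraph.ConnectedComponent.ind with | _ a
    induction B using SimpleGraph.ConnectedComponent.ind with | _ b
    have : G.Reachable (f a) (f b) := SimpleGraph.ConnectedComponent.eq.1 hAB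
    obtain ⟨p⟩ := this
    obtain ⟨b', hb', hr'⟩ := aux_walk hr hH p a rfl (hno a hA)
    rw [hf hb'] at hr'
    exact SimpleGraph.ConnectedComponent.eq.2 hr'
  have hTc : Tᶜ.ncard + 1 ≤ Nat.card G.ConnectedComponent := by
    rw [← hinj.ncard_image, ← Set.ncard_insert_of_notMem (a := G.connectedComponentMk x)]
    · exact Set.ncard_le_card _
    · rintro ⟨A, hA, h⟩
      induction A using SimpleGraph.ConnectedComponent.ind with | _ a
      have : G.Reachable (f a) x := SimpleGraph.ConnectedComponent.eq.1 h
      obtain ⟨p⟩ := this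
      obtain ⟨b', hb', hr'⟩ := aux_walk hr hH p a rfl (hno a hA)
      exact hx _ hb'
  have hsum : T.ncard + Tᶜ.ncard = Nat.card H.ConnectedComponent := Set.ncard_add_ncard_compl T
  have hTN : T.ncard ≤ N.ncard := Set.ncard_image_le (Set.toFinite _)
  refine ⟨by unfold cycDim; omega, fun hc => ?_⟩
  have : T.ncard < N.ncard := by
    refine lt_of_le_of_ne hTN fun heq => ?_
    obtain ⟨a, b, hab, ha, hb, h⟩ := aux_cycle hf hr hH hc
    exact hab (Set.injOn_of_ncard_image_eq heq (Set.toFinite _) ha hb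
      (SimpleGraph.ConnectedComponent.eq.2 h))
  unfold cycDim; omega

lemma exists_onCycle {V : Type*} [Finite V] [Nonempty V] (G : SimpleGraph V)
    (h : ∀ v, ∃ a b, a ≠ b ∧ G.Adj v a ∧ G.Adj v b) : ∃ x, OnCycle G x := by
  by_contra hcon
  have hac : G.IsAcyclic := fun v w hw => hcon ⟨v, v, w, hw, w.start_mem_support⟩
  obtain ⟨r⟩ := ‹Nonempty V›
  let c := G.connectedComponentMk r
  have ht := hac.isTree_connectedComponent c
  have hmem : ∀ v : c, ∀ a, G.Adj v a → a ∈ c.supp := by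
    intro v a hva
    have h1 : G.connectedComponentMk v.1 = c := v.2
    show G.connectedComponentMk a = c
    rw [← h1]
    exact SimpleGraph.ConnectedComponent.eq.2 hva.symm.reachable
  have : Fintype c := Fintype.ofFinite _
  let r' : c := ⟨r, rfl⟩
  obtain ⟨a, b, hab, ha, hb⟩ := h r
  have : Nontrivial c := ⟨r', ⟨a, hmem r' a ha⟩, fun he => ha.ne (congrArg Subtype.val he)⟩
  obtain ⟨v, hv⟩ := ht.exists_vert_degree_one_of_nontrivial
  rw [SimpleGraph.degree_eq_one_iff_existsUnique_adj] at hv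
  obtain ⟨a, b, hab, ha, hb⟩ := h v
  have h1 := hv.unique (y₁ := ⟨a, hmem v a ha⟩) (y₂ := ⟨b, hmem v b hb⟩) ha hb
  exact hab (congrArg Subtype.val h1)

/-! ### Rank part -/

lemma rank_rows {V W n : Type*} [Fintype V] [Fintype W] [Fintype n] (M : Matrix V n ℝ)
    {f : W → V} {x : V} (hr : ∀ v, v ≠ x → ∃ w, f w = v) :
    M.rank ≤ (M.submatrix f id).rank + 1 ∧
    ((∀ j, M x j = 0) → M.rank ≤ (M.submatrix f id).rank) := by
  rw [Matrix.rank_eq_finrank_span_row, Matrix.rank_eq_finrank_span_row]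
  have hsub : ∀ v, v ≠ x → M.row v ∈ Submodule.span ℝ (Set.range (M.submatrix f id).row) := by
    intro v hv
    obtain ⟨w, rfl⟩ := hr v hv
    exact Submodule.subset_span ⟨w, rfl⟩
  constructor
  · have h1 : Submodule.span ℝ (Set.range M.row) ≤
        Submodule.span ℝ {M.row x} ⊔ Submodule.span ℝ (Set.range (M.submatrix f id).row) := by
      rw [Submodule.span_le]
      rintro _ ⟨v, rfl⟩
      by_cases hv : v = x
      · subst hv
        exact Submodule.mem_sup_left (Submodule.subset_span rfl)
      · exact Submodule.mem_sup_right (hsub v hv)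
    have h2 := Submodule.finrank_mono h1
    have h3 := Submodule.finrank_add_le_finrank_add_finrank (Submodule.span ℝ {M.row x})
      (Submodule.span ℝ (Set.range (M.submatrix f id).row))
    have h4 : Module.finrank ℝ (Submodule.span ℝ {M.row x}) ≤ 1 := by
      simpa using finrank_span_le_card (R := ℝ) ({M.row x} : Set (n → ℝ))
    omega
  · intro h0
    apply Submodule.finrank_mono
    rw [Submodule.span_le]
    rintro _ ⟨v, rfl⟩
    by_cases hv : v = x
    · subst hv
      have : M.row v = 0 := funext h0
      rw [this]
      exact Submodule.zero_mem _
    · exact hsub v hv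

lemma rank_delete {V W : Type*} [Fintype V] [Fintype W] (M : Matrix V V ℝ)
    {f : W → V} {x : V} (hr : ∀ v, v ≠ x → ∃ w, f w = v) :
    M.rank ≤ (M.submatrix f f).rank + 2 ∧
    ((∀ j, M x j = 0) → (∀ j, M j x = 0) → M.rank ≤ (M.submatrix f f).rank) := by
  have h1 := rank_rows M hr
  have h2 := rank_rows (M.submatrix f id).transpose hr
  have e : ((M.submatrix f id).transpose.submatrix f id) = (M.submatrix f f).transpose := rfl
  rw [e, Matrix.rank_transpose, Matrix.rank_transpose] at h2
  refine ⟨by omega, fun ha hb => ?_⟩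
  exact (h1.2 ha).trans (h2.2 fun j => hb _)

lemma rank_pendant {V W : Type*} [Fintype V] [Fintype W] (M : Matrix V V ℝ)
    {f : W → V} {x y : V} (hf : Function.Injective f) (hxy : x ≠ y)
    (hx : ∀ w, f w ≠ x) (hy : ∀ w, f w ≠ y)
    (hr : ∀ v, v ≠ x → v ≠ y → ∃ w, f w = v)
    (h1 : ∀ j, j ≠ x → M y j = 0) (h2 : ∀ j, j ≠ x → M j y = 0)
    (h3 : M y x ≠ 0) (h4 : M x y ≠ 0) :
    M.rank = (M.submatrix f f).rank + 2 := by
  let e : Option (Option W) ≃ V := by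
    refine (Equiv.ofBijective
      (fun o : Option (Option W) => o.elim x (fun o => o.elim y f)) ⟨?_, ?_⟩)
    · rintro (_ | _ | a) (_ | _ | b) h
      · rfl
      · exact absurd h hxy
      · exact absurd h.symm (hx b)
      · exact absurd h.symm hxy
      · rfl
      · exact absurd h.symm (hy b)
      · exact absurd h (hx a)
      · exact absurd h (hy a)
      · exact congrArg (some ∘ some) (hf h)
    · intro v
      by_cases hv : v = x
      · exact ⟨none, hv.symm⟩
      by_cases hv' : v = y
      · exact ⟨some none, hv'.symm⟩
      · obtain ⟨w, hw⟩ := hr v hv hv'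
        exact ⟨some (some w), hw⟩
  have hcard : Fintype.card V = Fintype.card W + 2 := by
    rw [← Fintype.card_congr e]; simp
  have hsum : ∀ g : V → ℝ, ∑ v, g v = g x + (g y + ∑ w, g (f w)) := by
    intro g
    rw [← Equiv.sum_comp e g, Fintype.sum_option, Fintype.sum_option]
    rfl
  have hmv : ∀ (v : V → ℝ) i, (M.mulVec v) i
      = M i x * v x + (M i y * v y + ∑ w, M i (f w) * v (f w)) := by
    intro v i
    simp only [Matrix.mulVec, dotProduct]
    exact hsum _
  have hN : ∀ (v : W → ℝ) i, ((M.submatrix f f).mulVec v) i = ∑ w, M (f i) (f w) * v w := by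
    intro v i
    rfl
  have hker : ∀ v : V → ℝ, M.mulVec v = 0 → v x = 0 := by
    intro v hv
    have := congrFun hv y
    rw [hmv, h1 y hxy.symm] at this
    simp only [fun w => h1 _ (hx w), zero_mul, Finset.sum_const_zero, add_zero, Pi.zero_apply] at this
    exact (mul_eq_zero.1 this).resolve_left h3
  let L : LinearMap.ker M.mulVecLin →ₗ[ℝ] LinearMap.ker (M.submatrix f f).mulVecLin :=
    LinearMap.codRestrict _ ((LinearMap.funLeft ℝ ℝ f).comp (Submodule.subtype _)) (by
      rintro ⟨v, hv⟩
      rw [LinearMap.mem_ker, Matrix.mulVecLin_apply] at hv ⊢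
      funext i
      have := congrFun hv (f i)
      rw [hmv, hker v hv, h2 _ (hx i)] at this
      rw [hN]
      simpa using this)
  have hL : ∀ v w, (L v).1 w = v.1 (f w) := fun v w => rfl
  have hbij : Function.Bijective L := by
    constructor
    · rw [injective_iff_map_eq_zero]
      rintro ⟨v, hv⟩ h0
      rw [LinearMap.mem_ker, Matrix.mulVecLin_apply] at hv
      have hw : ∀ w, v (f w) = 0 := fun w => congrFun (congrArg Subtype.val h0) w
      have hvx := hker v hv
      have hvy : v y = 0 := by
        have := congrFun hv x
        rw [hmv, hvx] at this
        simp only [hw, mul_zero, Finset.sum_const_zero, add_zero, zero_add, Pi.zero_apply] at this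
        exact (mul_eq_zero.1 this).resolve_left h4
      apply Subtype.ext
      funext u
      by_cases hu : u = x
      · rw [hu]; exact hvx
      by_cases hu' : u = y
      · rw [hu']; exact hvy
      obtain ⟨w, rfl⟩ := hr u hu hu'
      exact hw w
    · rintro ⟨v, hv⟩
      rw [LinearMap.mem_ker, Matrix.mulVecLin_apply] at hv
      let g : Option (Option W) → ℝ := fun o =>
        o.elim 0 (fun o => o.elim (-(∑ w, M x (f w) * v w) / M x y) v)
      let u : V → ℝ := fun i => g (e.symm i)
      have hux : u x = 0 := by
        have : e.symm x = none := by rw [Equiv.symm_apply_eq]; rfl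
        simp only [u, this]; rfl
      have huy : u y = -(∑ w, M x (f w) * v w) / M x y := by
        have : e.symm y = some none := by rw [Equiv.symm_apply_eq]; rfl
        simp only [u, this]; rfl
      have huf : ∀ w, u (f w) = v w := by
        intro w
        have : e.symm (f w) = some (some w) := by rw [Equiv.symm_apply_eq]; rfl
        simp only [u, this]; rfl
      refine ⟨⟨u, ?_⟩, Subtype.ext (funext huf)⟩
      rw [LinearMap.mem_ker, Matrix.mulVecLin_apply]
      funext i
      rw [hmv, hux, huy]
      simp only [huf]
      by_cases hi : i = x
      · subst hi
        rw [mul_div_cancel₀ _ h4]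
        simp
      rw [h2 i hi]
      by_cases hi' : i = y
      · subst hi'
        simp [fun w => h1 _ (hx w)]
      obtain ⟨w, rfl⟩ := hr i hi hi'
      have := congrFun hv w
      rw [hN] at this
      simpa using this
  have hfin := (LinearEquiv.ofBijective L hbij).finrank_eq
  have r1 := M.mulVecLin.finrank_range_add_finrank_ker
  have r2 := (M.submatrix f f).mulVecLin.finrank_range_add_finrank_ker
  rw [Module.finrank_fintype_fun_eq_card] at r1 r2
  unfold Matrix.rank
  omega

/-! ### The general lower bound -/

lemma IsSkewAdjMatrix.sub {V W : Type*} {G : SimpleGraph V} {S : Matrix V V ℝ}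
    (hS : IsSkewAdjMatrix G S) (f : W → V) :
    IsSkewAdjMatrix (G.comap f) (S.submatrix f f) :=
  ⟨fun i j h => hS.1 _ _ h, fun i j h => hS.2.1 _ _ h, fun i j => hS.2.2 _ _⟩

lemma pendant_data {V W : Type*} [Fintype V] [Fintype W] {G : SimpleGraph V} {H : SimpleGraph W}
    {S : Matrix V V ℝ}
    (hS : IsSkewAdjMatrix G S) {x y : V} (hy : G.neighborSet y = {x}) {f : W → V}
    (hf : Function.Injective f) (hfx : ∀ w, f w ≠ x) (hfy : ∀ w, f w ≠ y)
    (hr : ∀ v, v ≠ x → v ≠ y → ∃ w, f w = v) (hH : ∀ a b, H.Adj a b ↔ G.Adj (f a) (f b)) :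
    S.rank = (S.submatrix f f).rank + 2 ∧
    (adjMat G).rank = ((adjMat G).submatrix f f).rank + 2 ∧
    cycDim H ≤ cycDim G ∧ (OnCycle G x → cycDim H + 1 ≤ cycDim G) := by
  have hadj : ∀ j, G.Adj y j ↔ j = x := by
    intro j
    rw [← SimpleGraph.mem_neighborSet, hy, Set.mem_singleton_iff]
  have hyx : G.Adj y x := (hadj x).2 rfl
  have hnz : ∀ {i j}, G.Adj i j → S i j ≠ 0 := by
    intro i j h
    rcases hS.1 i j h with h | h <;> rw [h] <;> norm_num
  have hnz' : ∀ {i j}, G.Adj i j → adjMat G i j ≠ 0 := by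
    intro i j h
    simp [adjMat, h]
  have hz' : ∀ {i j}, ¬ G.Adj i j → adjMat G i j = 0 := by
    intro i j h
    simp [adjMat, h]
  refine ⟨rank_pendant S hf hyx.ne' hfx hfy hr ?_ ?_ (hnz hyx) (hnz hyx.symm),
    rank_pendant _ hf hyx.ne' hfx hfy hr ?_ ?_ (hnz' hyx) (hnz' hyx.symm), ?_⟩
  · exact fun j hj => hS.2.1 _ _ (fun h => hj ((hadj j).1 h))
  · exact fun j hj => hS.2.1 _ _ (fun h => hj ((hadj j).1 h.symm))
  · exact fun j hj => hz' (fun h => hj ((hadj j).1 h))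
  · exact fun j hj => hz' (fun h => hj ((hadj j).1 h.symm))
  · have A := cycDim_delete_s17 (G := G) (H := G.comap (Subtype.val : {v // v ≠ x} → V))
      (f := Subtype.val) (x := x) Subtype.val_injective (fun w => w.2)
      (fun v hv => ⟨⟨v, hv⟩, rfl⟩) (fun a b => Iff.rfl)
    have B := cycDim_delete_s17 (G := G.comap (Subtype.val : {v // v ≠ x} → V)) (H := H)
      (f := fun w => ⟨f w, hfx w⟩) (x := ⟨y, hyx.ne⟩)
      (fun a b h => hf (congrArg Subtype.val h))
      (fun w h => hfy w (congrArg Subtype.val h))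
      (fun v hv => by
        obtain ⟨w, hw⟩ := hr v.1 v.2 (fun h => hv (Subtype.ext h))
        exact ⟨w, Subtype.ext hw⟩)
      hH
    exact ⟨B.1.trans A.1, fun h => by have := A.2 h; have := B.1; omega⟩

lemma adjMat_sub {V W : Type*} (G : SimpleGraph V) (f : W → V) :
    adjMat (G.comap f) = (adjMat G).submatrix f f := rfl

universe u in
lemma lower_bound (n : ℕ) : ∀ {V : Type u} [Fintype V] (G : SimpleGraph V) (S : Matrix V V ℝ),
    Fintype.card V = n → IsSkewAdjMatrix G S →
    ((adjMat G).rank : ℤ) ≤ S.rank + 2 * cycDim G := by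
  induction n using Nat.strong_induction_on with
  | _ n ih =>
  intro V _ G S hn hS
  rcases isEmpty_or_nonempty V with hV | hV
  · have h1 := (adjMat G).rank_le_card_width
    have h2 : G.edgeSet.ncard = 0 := by
      rw [Set.ncard_eq_zero]
      rw [Set.eq_empty_iff_forall_notMem]
      intro e
      induction e with
      | _ a b => exact isEmptyElim a
    have h3 : Nat.card V = 0 := by simp
    rw [Fintype.card_eq_zero] at h1
    unfold cycDim
    omega
  have del : ∀ x : V, ∃ r s d : ℤ, 
      r ≤ s + 2 * d ∧ s ≤ S.rank ∧ (adjMat G).rank ≤ r + 2 ∧ d ≤ cycDim G ∧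
      (OnCycle G x → d + 1 ≤ cycDim G) ∧
      ((∀ j, adjMat G x j = 0) → (∀ j, adjMat G j x = 0) → (adjMat G).rank ≤ r) := by
    intro x
    let f : {v // v ≠ x} → V := Subtype.val
    have hr : ∀ v, v ≠ x → ∃ w, f w = v := fun v hv => ⟨⟨v, hv⟩, rfl⟩
    have I := ih (Fintype.card {v // v ≠ x})
      (hn ▸ Fintype.card_subtype_lt (x := x) (by simp)) (G.comap f) (S.submatrix f f) rfl
      (hS.sub f)
    have R := rank_delete (adjMat G) hr
    have A := cycDim_delete_s17 (G := G) (H := G.comap f) (f := f) (x := x)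
      Subtype.val_injective (fun w => w.2) hr (fun a b => Iff.rfl)
    refine ⟨_, _, _, I, ?_, ?_, A.1, A.2, ?_⟩
    · exact_mod_cast Matrix.rank_submatrix_le S f f
    · exact_mod_cast R.1
    · intro a b
      exact_mod_cast R.2 a b
  by_cases h0 : ∃ x, ∀ j, ¬ G.Adj x j
  · obtain ⟨x, hx⟩ := h0
    obtain ⟨r, s, d, h1, h2, h3, h4, h5, h6⟩ := del x
    have := h6 (fun j => by simp [adjMat, hx]) (fun j => by simp [adjMat, G.adj_comm j, hx])
    omega
  by_cases h1 : ∃ x y, G.neighborSet y = {x}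
  · obtain ⟨x, y, hy⟩ := h1
    let f : {v // v ≠ x ∧ v ≠ y} → V := Subtype.val
    obtain ⟨h1, h2, h3, -⟩ := pendant_data (H := G.comap f) hS hy (f := f)
      Subtype.val_injective (fun w => w.2.1) (fun w => w.2.2) (fun v a b => ⟨⟨v, a, b⟩, rfl⟩)
      (fun a b => Iff.rfl)
    have I := ih (Fintype.card {v // v ≠ x ∧ v ≠ y})
      (hn ▸ Fintype.card_subtype_lt (x := x) (by simp)) (G.comap f) (S.submatrix f f) rfl
      (hS.sub f)
    rw [adjMat_sub] at I
    omega
  obtain ⟨x, hx⟩ := exists_onCycle G (by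
    intro v
    push Not at h0 h1
    obtain ⟨a, ha⟩ := h0 v
    have := h1 a v
    by_contra hcon
    push Not at hcon
    apply this
    ext b
    simp only [SimpleGraph.mem_neighborSet, Set.mem_singleton_iff]
    constructor
    · intro hb
      by_contra hne
      exact hcon a b (Ne.symm hne) ha hb
    · rintro rfl
      exact ha)
  obtain ⟨r, s, d, h1, h2, h3, h4, h5, h6⟩ := del x
  have := h5 hx
  omega

/-- If G^σ is lower-optimal and y is a pendant vertex of G with unique
neighbor x, then x lies on no cycle of G and H^σ = G^σ - x - y is also
lower-optimal. -/
theorem lowerOptimal_delete_pendant {V : Type*} [Fintype V] [DecidableEq V]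
    (G : SimpleGraph V) (S : Matrix V V ℝ) (hS : IsSkewAdjMatrix G S)
    (hlo : (S.rank : ℤ) = ((adjMat G).rank : ℤ) - 2 * cycDim G)
    (x y : V) (hy : G.neighborSet y = {x}) :
    ¬ OnCycle G x ∧
    (((S.submatrix (fun w : ({x, y}ᶜ : Finset V) => (w : V))
        (fun w : ({x, y}ᶜ : Finset V) => (w : V))).rank : ℤ) =
      (((adjMat G).submatrix (fun w : ({x, y}ᶜ : Finset V) => (w : V))
        (fun w : ({x, y}ᶜ : Finset V) => (w : V))).rank : ℤ) -
      2 * cycDim (G.induce (↑({x, y}ᶜ : Finset V) : Set V))) := by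
  have hz : ∀ w : ({x, y}ᶜ : Finset V), (w : V) ≠ x ∧ (w : V) ≠ y := by
    intro w
    have := w.2
    simpa [not_or] using this
  obtain ⟨h1, h2, h3, h4⟩ := pendant_data
    (W := ({x, y}ᶜ : Finset V)) (H := G.induce (↑({x, y}ᶜ : Finset V) : Set V))
    hS hy (f := fun w : ({x, y}ᶜ : Finset V) => (w : V))
    Subtype.val_injective (fun w => (hz w).1) (fun w => (hz w).2)
    (fun v a b => ⟨⟨v, by simp [a, b]⟩, rfl⟩) (fun a b => Iff.rfl)
  have I := lower_bound _ (V := ({x, y}ᶜ : Finset V))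
    (G.induce (↑({x, y}ᶜ : Finset V) : Set V)) _ rfl
    (hS.sub (fun w : ({x, y}ᶜ : Finset V) => (w : V)))
  have E : adjMat (V := ({x, y}ᶜ : Finset V)) (G.induce (↑({x, y}ᶜ : Finset V) : Set V)) =
    (adjMat G).submatrix (fun w : ({x, y}ᶜ : Finset V) => (w : V))
        (fun w : ({x, y}ᶜ : Finset V) => (w : V)) := rfl
  rw [E] at I
  constructor
  · intro hc
    have := h4 hc
    omega
  · omega
end

section
/- Let C_q^σ be a pendant oriented cycle of G^σ with x the unique vertex of C_q of degree 3 in G, and set H^σ = G^σ − C_q^σ and K^σ = H^σ + x. If G^σ is lower-optimal, then q ≡ 2 (mod 4), C_q^σ is evenly-oriented, sr(G^σ) = q − 2 + sr(K^σ), sr(H^σ) = sr(K^σ), r(G) = q + r(K), r(H) = r(K), and both H^σ and K^σ are lower-optimal. -/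
open scoped Classical

section RankLemmas

variable {V : Type*} [Fintype V]

theorem pc_rank_add_le (A B : Matrix V V ℝ) : (A + B).rank ≤ A.rank + B.rank := by
  unfold Matrix.rank
  rw [Matrix.mulVecLin_add]
  refine le_trans (Submodule.finrank_mono ?_)
    (Submodule.finrank_add_le_finrank_add_finrank (LinearMap.range A.mulVecLin)
      (LinearMap.range B.mulVecLin))
  rintro _ ⟨v, rfl⟩
  exact Submodule.add_mem_sup ⟨v, rfl⟩ ⟨v, rfl⟩

/-- Wedderburn rank reduction. -/
theorem pc_pivot (M : Matrix V V ℝ) (a b : V) (h : M a b ≠ 0) :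
    M.rank = 1 + (Matrix.of fun i j => M i j - M i b * M a j / M a b).rank := by
  set M' : Matrix V V ℝ := Matrix.of fun i j => M i j - M i b * M a j / M a b with hM'
  apply le_antisymm
  · have e : M = Matrix.vecMulVec (fun i => M i b) (fun j => M a j / M a b) + M' := by
      ext i j
      simp [hM', Matrix.vecMulVec_apply]
      ring
    calc M.rank = (Matrix.vecMulVec (fun i => M i b) (fun j => M a j / M a b) + M').rank := by
          rw [← e]
      _ ≤ _ := pc_rank_add_le _ _
      _ ≤ 1 + M'.rank := by gcongr; exact Matrix.rank_vecMulVec_le _ _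
  · rw [add_comm, Nat.add_one_le_iff]
    unfold Matrix.rank
    apply Submodule.finrank_lt_finrank_of_lt
    have key : ∀ v, M'.mulVec v = M.mulVec (v - Pi.single b ((∑ j, M a j * v j) / M a b)) := by
      intro v
      ext i
      rw [Matrix.mulVec_sub, Pi.sub_apply, Matrix.mulVec_single]
      simp only [Matrix.mulVec, dotProduct, hM', Matrix.of_apply, sub_mul, Finset.sum_sub_distrib]
      congr 1
      simp only [Pi.smul_apply, Matrix.col_apply, MulOpposite.smul_eq_mul_unop, MulOpposite.unop_op]
      rw [Finset.sum_div, Finset.mul_sum]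
      refine Finset.sum_congr rfl fun j _ => by ring
    have hz : ∀ v, M'.mulVec v a = 0 := by
      intro v
      simp only [Matrix.mulVec, dotProduct, hM', Matrix.of_apply]
      refine Finset.sum_eq_zero fun j _ => ?_
      field_simp
      ring
    refine lt_of_le_of_ne ?_ ?_
    · rintro _ ⟨v, rfl⟩
      exact ⟨_, (key v).symm⟩
    · intro heq
      have hm : M.mulVec (Pi.single b 1) ∈ LinearMap.range M'.mulVecLin := by
        rw [heq]; exact ⟨_, rfl⟩
      obtain ⟨v, hv⟩ := hm
      have := congrFun hv a
      rw [Matrix.mulVecLin_apply, hz v] at this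
      simp at this
      exact h this.symm

/-- weighted edge between `a` and `b` -/
noncomputable def pcN (ε : ℝ) (a b : V) (w : ℝ) : Matrix V V ℝ :=
  Matrix.of fun i j => (if i = a ∧ j = b then w else 0) + (if i = b ∧ j = a then ε * w else 0)

noncomputable def pcRes (M : Matrix V V ℝ) (P : V → Prop) : Matrix V V ℝ :=
  Matrix.of fun i j => if P i ∧ P j then M i j else 0

theorem pc_two_pivot (M M' : Matrix V V ℝ) (a b : V) (hab : a ≠ b)
    (h1 : M a b ≠ 0) (h2 : M b a ≠ 0) (h3 : M a a = 0) (h4 : M b b = 0)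
    (hM' : ∀ i j, M' i j = M i j - M i b * M a j / M a b - M i a * M b j / M b a) :
    M.rank = 2 + M'.rank := by
  rw [pc_pivot M a b h1, pc_pivot _ b a (by simpa [h4] using h2)]
  rw [← add_assoc]
  congr 2
  ext i j
  simp [hM', h3, h4]

theorem pc_elim (ε : ℝ) (hε : ε * ε = 1) (C : Matrix V V ℝ) (x y p q : V) (a b c : ℝ)
    (hb : b * b = 1)
    (hpq : p ≠ q) (hxp : x ≠ p) (hxq : x ≠ q) (hyp : y ≠ p) (hyq : y ≠ q)
    (hC1 : ∀ j, C p j = 0) (hC2 : ∀ j, C j p = 0) (hC3 : ∀ j, C q j = 0) (hC4 : ∀ j, C j q = 0) :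
    (C + pcN ε x p a + pcN ε p q b + pcN ε q y c).rank
      = 2 + (C + pcN ε x y (-ε * (a * b * c))).rank := by
  have hb0 : b ≠ 0 := by rintro rfl; simp at hb
  have hε0 : ε ≠ 0 := by rintro rfl; simp at hε
  have bi : b⁻¹ = b := (eq_inv_of_mul_eq_one_left hb).symm
  have ei : ε⁻¹ = ε := (eq_inv_of_mul_eq_one_left hε).symm
  apply pc_two_pivot _ _ p q hpq
  · simp [pcN, hC1, hpq, hpq.symm, hxp, hxq, hyp, hyq, hxp.symm, hxq.symm, hyp.symm, hyq.symm, hb0]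
  · simp [pcN, hC3, hpq, hpq.symm, hxp, hxq, hyp, hyq, hxp.symm, hxq.symm, hyp.symm, hyq.symm, hb0, hε0]
  · simp [pcN, hC1, hpq, hpq.symm, hxp, hxq, hyp, hyq, hxp.symm, hxq.symm, hyp.symm, hyq.symm]
  · simp [pcN, hC3, hpq, hpq.symm, hxp, hxq, hyp, hyq, hxp.symm, hxq.symm, hyp.symm, hyq.symm]
  · intro i j
    have e2 : ε ^ 2 = 1 := by rw [pow_two, hε]
    have e3 : ε ^ 3 = ε := by rw [pow_succ, e2, one_mul]
    simp only [pcN, Matrix.add_apply, Matrix.of_apply, hC1, hC3, hC2, hC4, hpq, hpq.symm, hxp, hxq,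
      hyp, hyq, hxp.symm, hxq.symm, hyp.symm, hyq.symm, and_false, false_and, if_false, true_and,
      and_true, if_true, add_zero, zero_add, div_eq_mul_inv, mul_inv, bi, ei]
    have b2 : b ^ 2 = 1 := by rw [pow_two, hb]
    have b3 : b ^ 3 = b := by rw [pow_succ, b2, one_mul]
    by_cases hip : i = p
    · subst hip
      simp only [hC1, hxp.symm, hyp.symm, hpq, true_and, false_and, if_false, if_true]
      split_ifs <;> first | (exfalso; simp_all; done) |
        (ring_nf; try simp only [e2, e3, b2, b3]; try ring)
    by_cases hiq : i = q
    · subst hiq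
      simp only [hC3, hxq.symm, hyq.symm, hpq.symm, true_and, false_and, if_false, if_true]
      split_ifs <;> first | (exfalso; simp_all; done) |
        (ring_nf; try simp only [e2, e3, b2, b3]; try ring)
    by_cases hjp : j = p
    · subst hjp
      simp only [hC2, hxp.symm, hyp.symm, hpq, hip, hiq, and_true, and_false, true_and, false_and,
        if_false, if_true]
      split_ifs <;> first | (exfalso; simp_all; done) |
        (ring_nf; try simp only [e2, e3, b2, b3]; try ring)
    by_cases hjq : j = q
    · subst hjq
      simp only [hC4, hxq.symm, hyq.symm, hpq.symm, hip, hiq, and_true, and_false, true_and,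
        false_and, if_false, if_true]
      split_ifs <;> first | (exfalso; simp_all; done) |
        (ring_nf; try simp only [e2, e3, b2, b3]; try ring)
    simp only [hip, hiq, hjp, hjq, and_true, and_false, true_and, false_and, if_false, if_true]
    generalize (i = x) = P1
    generalize (j = y) = P2
    generalize (i = y) = P3
    generalize (j = x) = P4
    by_cases h1 : P1 <;> by_cases h2 : P2 <;> by_cases h3 : P3 <;> by_cases h4 : P4 <;>
      simp only [h1, h2, h3, h4, and_true, and_false, true_and, false_and, if_false, if_true] <;>
      ring_nf <;> simp only [e2, e3, b2, b3] <;> ring_nf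

theorem pc_pendant (ε : ℝ) (hε : ε * ε = 1) (C : Matrix V V ℝ) (x p : V) (w : ℝ) (hw : w ≠ 0)
    (hxp : x ≠ p) (hC1 : ∀ j, C p j = 0) (hC2 : ∀ j, C j p = 0) (hxx : C x x = 0) :
    (C + pcN ε x p w).rank = 2 + (pcRes C (fun i => i ≠ x)).rank := by
  have hε0 : ε ≠ 0 := by rintro rfl; simp at hε
  apply pc_two_pivot _ _ x p hxp
  · simp [pcN, hC2, hxp, hxp.symm, hw]
  · simp [pcN, hC1, hxp, hxp.symm, hw, hε0]
  · simp [pcN, hxx, hxp, hxp.symm, hw, hε0]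
  · simp [pcN, hC2, hxp, hxp.symm, hw, hε0]
  · intro i j
    simp only [pcN, pcRes, Matrix.add_apply, Matrix.of_apply, hC1, hC2, hxp, hxp.symm, and_false, false_and,
      if_false, true_and, and_true, if_true, add_zero, zero_add]
    by_cases hi : i = x <;> by_cases hj : j = x <;> by_cases hi' : i = p <;> by_cases hj' : j = p <;>
      simp_all
    

end RankLemmas

section RankLemmas2

variable {V : Type*} [Fintype V]

theorem pcN_zero (ε : ℝ) (a b : V) : pcN ε a b 0 = 0 := by
  ext i j; simp [pcN]

theorem pcN_swap (ε : ℝ) (hε : ε * ε = 1) (a b : V) (w : ℝ) :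
    pcN ε a b w = pcN ε b a (ε * w) := by
  ext i j
  simp only [pcN, Matrix.of_apply, ← mul_assoc, hε, one_mul]
  ring

theorem pcN_add (ε : ℝ) (a b : V) (w w' : ℝ) :
    pcN ε a b w + pcN ε a b w' = pcN ε a b (w + w') := by
  ext i j
  simp only [pcN, Matrix.of_apply, Matrix.add_apply]
  split_ifs <;> ring

theorem pcN_row (ε : ℝ) (a b p : V) (w : ℝ) (ha : p ≠ a) (hb : p ≠ b) (j : V) :
    pcN ε a b w p j = 0 := by
  simp [pcN, ha, hb]

theorem pcN_col (ε : ℝ) (a b p : V) (w : ℝ) (ha : p ≠ a) (hb : p ≠ b) (j : V) :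
    pcN ε a b w j p = 0 := by
  simp [pcN, ha, hb]

theorem pc_path (ε : ℝ) (hε : ε * ε = 1) (v : ℕ → V) (a : ℕ → ℝ) (t : ℕ) :
    ∀ (C : Matrix V V ℝ), (∀ k, k ≤ 2 * t → a k * a k = 1) →
    (∀ k l, 1 ≤ k → k ≤ 2 * t → l ≤ 2 * t + 1 → k ≠ l → v k ≠ v l) →
    (∀ k, 1 ≤ k → k ≤ 2 * t → ∀ j, C (v k) j = 0 ∧ C j (v k) = 0) →
    (C + ∑ k ∈ Finset.range (2 * t + 1), pcN ε (v k) (v (k + 1)) (a k)).rank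
      = 2 * t + (C + pcN ε (v 0) (v (2 * t + 1))
          ((-ε) ^ t * ∏ k ∈ Finset.range (2 * t + 1), a k)).rank := by
  induction t with
  | zero => intro C _ _ _; simp
  | succ t ih =>
    intro C ha hv hC
    set C' := C + pcN ε (v (2 * t + 1)) (v (2 * t + 2)) (a (2 * t + 1))
      + pcN ε (v (2 * t + 2)) (v (2 * t + 3)) (a (2 * t + 2)) with hC'
    have e1 : C + ∑ k ∈ Finset.range (2 * (t + 1) + 1), pcN ε (v k) (v (k + 1)) (a k)
        = C' + ∑ k ∈ Finset.range (2 * t + 1), pcN ε (v k) (v (k + 1)) (a k) := by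
      rw [show 2 * (t + 1) + 1 = 2 * t + 1 + 1 + 1 by ring, Finset.sum_range_succ,
        Finset.sum_range_succ, hC']
      abel
    rw [e1, ih C' (fun k hk => ha k (by omega))
      (fun k l h1 h2 h3 h4 => hv k l h1 (by omega) (by omega) h4)]
    · set w := (-ε) ^ t * ∏ k ∈ Finset.range (2 * t + 1), a k with hw
      have e2 : C' + pcN ε (v 0) (v (2 * t + 1)) w = C + pcN ε (v 0) (v (2 * t + 1)) w
          + pcN ε (v (2 * t + 1)) (v (2 * t + 2)) (a (2 * t + 1))
          + pcN ε (v (2 * t + 2)) (v (2 * t + 3)) (a (2 * t + 2)) := by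
        rw [hC']; abel
      rw [e2, pc_elim ε hε C (v 0) (v (2 * t + 3)) (v (2 * t + 1)) (v (2 * t + 2)) w
        (a (2 * t + 1)) (a (2 * t + 2)) (ha _ (by omega))
        (hv _ _ (by omega) (by omega) (by omega) (by omega))
        (hv _ _ (by omega) (by omega) (by omega) (by omega)).symm
        (hv _ _ (by omega) (by omega) (by omega) (by omega)).symm
        (hv _ _ (by omega) (by omega) (by omega) (by omega)).symm
        (hv _ _ (by omega) (by omega) (by omega) (by omega)).symm
        (fun j => (hC _ (by omega) (by omega) j).1)
        (fun j => (hC _ (by omega) (by omega) j).2)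
        (fun j => (hC _ (by omega) (by omega) j).1)
        (fun j => (hC _ (by omega) (by omega) j).2)]
      rw [show 2 * (t + 1) + 1 = 2 * t + 1 + 1 + 1 by ring, Finset.prod_range_succ,
        Finset.prod_range_succ, ← add_assoc, show 2 * t + 2 = 2 * (t + 1) by ring]
      congr 4
      rw [hw]
      ring
    · intro k h1 h2 j
      have hne : ∀ l, l ≤ 2 * t + 3 → k ≠ l → v k ≠ v l := fun l hl hkl =>
        hv k l h1 (by omega) (by omega) hkl
      have n1 := hne (2 * t + 1) (by omega) (by omega)
      have n2 := hne (2 * t + 2) (by omega) (by omega)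
      have n3 := hne (2 * t + 3) (by omega) (by omega)
      have := hC k h1 (by omega) j
      simp [hC', pcN_row, pcN_col, n1, n2, n3, this]

theorem pc_rank_res (M : Matrix V V ℝ) (s : Finset V) :
    (M.submatrix (fun w : s => (w : V)) (fun w : s => (w : V))).rank
      = (pcRes M (fun i => i ∈ s)).rank := by
  apply le_antisymm
  · have : M.submatrix (fun w : s => (w : V)) (fun w : s => (w : V))
        = (pcRes M (fun i => i ∈ s)).submatrix (fun w : s => (w : V)) (fun w : s => (w : V)) := by
      ext i j
      simp [pcRes]
    rw [this]
    exact Matrix.rank_submatrix_le _ _ _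
  · let P : Matrix V s ℝ := Matrix.of fun i w => if i = (w : V) then 1 else 0
    have : pcRes M (fun i => i ∈ s)
        = P * M.submatrix (fun w : s => (w : V)) (fun w : s => (w : V)) * P.transpose := by
      ext i j
      simp only [Matrix.mul_apply, P, Matrix.of_apply, Matrix.transpose_apply, pcRes,
        Matrix.submatrix_apply]
      by_cases hi : i ∈ s
      · by_cases hj : j ∈ s
        · rw [if_pos ⟨hi, hj⟩, Finset.sum_eq_single (⟨j, hj⟩ : s), Finset.sum_eq_single (⟨i, hi⟩ : s)]
          · simp
          · rintro ⟨b, hb⟩ _ hne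
            rw [if_neg (fun h => hne (Subtype.ext h.symm))]; simp
          · simp
          · rintro ⟨b, hb⟩ _ hne
            rw [if_neg (fun h => hne (Subtype.ext h.symm))]; simp
          · simp
        · rw [if_neg (fun h => hj h.2)]
          symm
          refine Finset.sum_eq_zero ?_
          rintro ⟨b, hb⟩ _
          rw [if_neg (fun h => hj (by rw [h]; exact hb))]; simp
      · rw [if_neg (fun h => hi h.1)]
        symm
        refine Finset.sum_eq_zero ?_
        rintro ⟨b, hb⟩ _
        rw [Finset.sum_eq_zero]
        · simp
        · rintro ⟨b, hb⟩ _
          rw [if_neg (fun h => hi (by rw [h]; exact hb))]; simp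
    rw [this]
    exact (Matrix.rank_mul_le_left _ _).trans (Matrix.rank_mul_le_right _ _)

theorem pc_rank_bad (B : Finset (Sym2 V)) : ∀ (M : Matrix V V ℝ),
    (∀ i j, M i j ≠ 0 → s(i, j) ∈ B) → M.rank ≤ 2 * B.card := by
  induction B using Finset.induction_on with
  | empty =>
    intro M hM
    have : M = 0 := by
      ext i j
      by_contra h
      simpa using hM i j h
    simp [this]
  | insert e B he ih =>
    intro M hM
    induction e using Sym2.ind with
    | _ p q =>
    let M1 : Matrix V V ℝ := Matrix.of fun i j => if s(i, j) ∈ B then M i j else 0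
    let u : V → ℝ := fun i => if i = p then 1 else 0
    let u' : V → ℝ := fun i => if i = q then 1 else 0
    let r1 : V → ℝ := fun j => if j = q then M p q else 0
    let r2 : V → ℝ := fun j => if j = p ∧ p ≠ q then M q p else 0
    have : M = M1 + (Matrix.vecMulVec u r1 + Matrix.vecMulVec u' r2) := by
      ext i j
      simp only [M1, u, u', r1, r2, Matrix.add_apply, Matrix.of_apply, Matrix.vecMulVec_apply]
      by_cases h : s(i, j) ∈ B
      · have hne : s(i, j) ≠ s(p, q) := fun h' => he (h' ▸ h)
        rw [Ne, Sym2.eq_iff] at hne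
        rw [if_pos h]
        by_cases h1 : i = p <;> by_cases h2 : j = q <;> by_cases h3 : i = q <;> by_cases h4 : j = p <;>
          simp_all
      · rw [if_neg h]
        by_cases hne : s(i, j) = s(p, q)
        · rcases Sym2.eq_iff.1 hne with ⟨rfl, rfl⟩ | ⟨rfl, rfl⟩
          · by_cases hh : i = j <;> simp [hh]
          · by_cases hh : i = j
            · simp [hh]
            · simp [hh]
              tauto
        · have hz : M i j = 0 := by
            by_contra h0
            rcases Finset.mem_insert.1 (hM i j h0) with h1 | h1
            · exact hne h1
            · exact h h1
          rw [Sym2.eq_iff] at hne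
          rw [hz]
          by_cases h1 : i = p <;> by_cases h2 : j = q <;> by_cases h3 : i = q <;> by_cases h4 : j = p <;>
          simp_all
    rw [this, Finset.card_insert_of_notMem he]
    have h1 : M1.rank ≤ 2 * B.card := ih M1 (by
      intro i j h
      by_contra h'
      simp [M1, h'] at h)
    have h2 := pc_rank_add_le M1 (Matrix.vecMulVec u r1 + Matrix.vecMulVec u' r2)
    have h3 := pc_rank_add_le (Matrix.vecMulVec u r1) (Matrix.vecMulVec u' r2)
    have h4 := Matrix.rank_vecMulVec_le u r1
    have h5 := Matrix.rank_vecMulVec_le u' r2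
    omega

/-- removing one vertex changes the rank by at most two -/
theorem pc_rank_res_vertex (M : Matrix V V ℝ) (x : V) :
    M.rank ≤ (pcRes M (fun i => i ≠ x)).rank + 2 := by
  let u : V → ℝ := fun i => if i = x then 1 else 0
  let r1 : V → ℝ := fun j => M x j
  let r2 : V → ℝ := fun i => if i = x then 0 else M i x
  have : M = pcRes M (fun i => i ≠ x) + (Matrix.vecMulVec u r1 + Matrix.vecMulVec r2 u) := by
    ext i j
    simp only [pcRes, u, r1, r2, Matrix.add_apply, Matrix.of_apply, Matrix.vecMulVec_apply]
    by_cases h1 : i = x <;> by_cases h2 : j = x <;> simp [h1, h2]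
  have h2 := pc_rank_add_le (pcRes M (fun i => i ≠ x)) (Matrix.vecMulVec u r1 + Matrix.vecMulVec r2 u)
  have h3 := pc_rank_add_le (Matrix.vecMulVec u r1) (Matrix.vecMulVec r2 u)
  have h4 := Matrix.rank_vecMulVec_le u r1
  have h5 := Matrix.rank_vecMulVec_le r2 u
  rw [← this] at h2
  omega

theorem pc_rank_loop (C : Matrix V V ℝ) (ε w : ℝ) (x : V) :
    (C + pcN ε x x w).rank ≤ C.rank + 1 := by
  have : pcN ε x x w = Matrix.vecMulVec (fun i => if i = x then (1 + ε) * w else 0)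
      (fun i => if i = x then 1 else 0) := by
    ext i j
    simp only [pcN, Matrix.of_apply, Matrix.vecMulVec_apply]
    by_cases h1 : i = x <;> by_cases h2 : j = x <;> simp [h1, h2]
    ring
  refine (pc_rank_add_le _ _).trans ?_
  gcongr
  rw [this]
  exact Matrix.rank_vecMulVec_le _ _

theorem pcN_loop_skew (w : ℝ) (x : V) : pcN (-1) x x w = 0 := by
  ext i j
  simp only [pcN, Matrix.of_apply, Matrix.zero_apply]
  split_ifs <;> ring

end RankLemmas2

section Gauge

variable {V : Type*}

theorem pc_const_reach {β : Type*} (G : SimpleGraph V) (f : V → β)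
    (h : ∀ i j, G.Adj i j → f i = f j) {i j : V} (hr : G.Reachable i j) : f i = f j := by
  obtain ⟨p⟩ := hr
  induction p with
  | nil => rfl
  | cons h' _ ih => exact (h _ _ h').trans ih

theorem pc_lift {β : Type*} (G : SimpleGraph V) (f : V → β)
    (h : ∀ i j, G.Adj i j → f i = f j) :
    ∃ φ : G.ConnectedComponent → β, ∀ v, φ (G.connectedComponentMk v) = f v :=
  ⟨SimpleGraph.ConnectedComponent.lift f (fun _ _ p _ => pc_const_reach G f h ⟨p⟩), fun _ => rfl⟩

theorem pc_comp1 [Fintype V] (G G' : SimpleGraph V) (a b : V)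
    (hG : ∀ i j, G.Adj i j → G'.Adj i j ∨ s(i, j) = s(a, b)) :
    Nat.card G'.ConnectedComponent ≤ Nat.card G.ConnectedComponent + 1 := by
  let f : V → G'.ConnectedComponent := fun v =>
    if G'.connectedComponentMk v = G'.connectedComponentMk b then G'.connectedComponentMk a
    else G'.connectedComponentMk v
  obtain ⟨φ, hφ⟩ := pc_lift G f (by
    intro i j hij
    rcases hG i j hij with h | h
    · have : G'.connectedComponentMk i = G'.connectedComponentMk j :=
        SimpleGraph.ConnectedComponent.sound h.reachable
      simp only [f, this]
    · rcases Sym2.eq_iff.1 h with ⟨rfl, rfl⟩ | ⟨rfl, rfl⟩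
      · simp [f]
      · simp [f])
  let ψ : Option G.ConnectedComponent → G'.ConnectedComponent := fun o =>
    match o with
    | none => G'.connectedComponentMk b
    | some c => φ c
  have hs : Function.Surjective ψ := by
    intro c
    induction c using SimpleGraph.ConnectedComponent.ind with
    | _ v =>
    by_cases h : G'.connectedComponentMk v = G'.connectedComponentMk b
    · exact ⟨none, h.symm⟩
    · refine ⟨some (G.connectedComponentMk v), ?_⟩
      simp only [ψ, hφ, f, if_neg h]
  have := Nat.card_le_card_of_surjective ψ hs
  rwa [Finite.card_option] at this

theorem pc_comp2 [Fintype V] (G G' : SimpleGraph V) (a b : V)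
    (hG : ∀ i j, G.Adj i j → G'.Adj i j ∨ s(i, j) = s(a, b)) (hr : G'.Reachable a b) :
    Nat.card G'.ConnectedComponent ≤ Nat.card G.ConnectedComponent := by
  obtain ⟨φ, hφ⟩ := pc_lift G G'.connectedComponentMk (by
    intro i j hij
    apply SimpleGraph.ConnectedComponent.sound
    rcases hG i j hij with h | h
    · exact h.reachable
    · rcases Sym2.eq_iff.1 h with ⟨rfl, rfl⟩ | ⟨rfl, rfl⟩
      · exact hr
      · exact hr.symm)
  refine Nat.card_le_card_of_surjective φ ?_
  intro c
  induction c using SimpleGraph.ConnectedComponent.ind with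
  | _ v => exact ⟨_, hφ v⟩

theorem pc_gauge [Fintype V] (S : Matrix V V ℝ) (hskew : ∀ i j, S j i = - S i j) (n : ℕ) :
    ∀ G : SimpleGraph V, G.edgeSet.ncard = n →
    (∀ i j, G.Adj i j → S i j = 1 ∨ S i j = -1) →
    ∃ g h : V → ℝ, (∀ v, g v = 1 ∨ g v = -1) ∧ (∀ v, h v = 1 ∨ h v = -1) ∧
      ∃ B : Finset (Sym2 V), (B.card : ℤ) ≤ cycDim G ∧
        ∀ i j, G.Adj i j → s(i, j) ∉ B → g i * S i j * h j = 1 := by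
  induction n with
  | zero =>
    intro G hn _
    have he : G.edgeSet = ∅ := (Set.ncard_eq_zero (Set.toFinite _)).1 hn
    have hno : ∀ i j, ¬ G.Adj i j := fun i j hij => by
      have : s(i, j) ∈ G.edgeSet := hij
      rw [he] at this; exact this
    refine ⟨fun _ => 1, fun _ => 1, by simp, by simp, ∅, ?_, fun i j hij => absurd hij (hno i j)⟩
    have : Nat.card V ≤ Nat.card G.ConnectedComponent := by
      obtain ⟨φ, hφ⟩ := pc_lift G id (fun i j hij => absurd hij (hno i j))
      exact Nat.card_le_card_of_surjective φ (fun v => ⟨_, hφ v⟩)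
    unfold cycDim
    rw [hn]
    simp only [Finset.card_empty]
    push_cast
    omega
  | succ n ih =>
    intro G hn hS
    have hne : G.edgeSet.Nonempty := by
      rw [← Set.ncard_pos (Set.toFinite _)]; omega
    obtain ⟨e, he⟩ := hne
    induction e using Sym2.ind with
    | _ a b =>
    have hab : G.Adj a b := he
    set G' := G.deleteEdges {s(a, b)} with hG'
    have hadj' : ∀ i j, G'.Adj i j ↔ G.Adj i j ∧ s(i, j) ≠ s(a, b) := by
      intro i j
      rw [hG', SimpleGraph.deleteEdges_adj, Set.mem_singleton_iff]
    have hcov : ∀ i j, G.Adj i j → G'.Adj i j ∨ s(i, j) = s(a, b) := by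
      intro i j hij
      by_cases h : s(i, j) = s(a, b)
      · exact Or.inr h
      · exact Or.inl ((hadj' i j).2 ⟨hij, h⟩)
    have hn' : G'.edgeSet.ncard = n := by
      rw [hG', SimpleGraph.edgeSet_deleteEdges, Set.ncard_diff_singleton_of_mem he, hn]
      rfl
    obtain ⟨g, h, hg, hh, B, hB, hgood⟩ := ih G' hn' (fun i j hij => hS i j ((hadj' i j).1 hij).1)
    by_cases hr : G'.Reachable a b
    · refine ⟨g, h, hg, hh, insert s(a, b) B, ?_, ?_⟩
      · have h1 := pc_comp2 G G' a b hcov hr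
        have h2 := Finset.card_insert_le s(a, b) B
        unfold cycDim at hB ⊢
        rw [hn'] at hB
        rw [hn]
        push_cast
        omega
      · intro i j hij hnot
        rw [Finset.mem_insert, not_or] at hnot
        exact hgood i j ((hadj' i j).2 ⟨hij, hnot.1⟩) hnot.2
    · -- transform on the component of `b`
      have key : ∃ g' h' : V → ℝ, (∀ v, g' v = 1 ∨ g' v = -1) ∧ (∀ v, h' v = 1 ∨ h' v = -1) ∧
          (∀ i j, G'.Adj i j → s(i, j) ∉ B → g' i * S i j * h' j = 1) ∧
          h' b = g a * S a b ∧ g' b = - (h a * S a b) := by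
        have h1 := hS a b hab
        have hga := hg a
        have hha := hh a
        have hgb := hg b
        have hhb := hh b
        have R1 : ∀ i j, G'.Adj i j → s(i, j) ∉ B → g i * S i j * h j = 1 ∧
            h i * S i j * g j = -1 := by
          intro i j hij hb
          refine ⟨hgood i j hij hb, ?_⟩
          have := hgood j i hij.symm (by rwa [Sym2.eq_swap])
          rw [hskew i j] at this
          linarith
        by_cases hc : (g a * S a b) * h b = - (h a * S a b) * g b
        · have hs : (g a * S a b) * h b = 1 ∨ (g a * S a b) * h b = -1 := by
            rcases hga with q1 | q1 <;> rcases h1 with q2 | q2 <;> rcases hhb with q3 | q3 <;>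
              simp [q1, q2, q3]
          set s := (g a * S a b) * h b with hsdef
          refine ⟨fun v => s * g v, fun v => s * h v, ?_, ?_, ?_, ?_, ?_⟩
          · intro v
            rcases hs with q1 | q1 <;> rcases hg v with q2 | q2 <;> simp [q1, q2]
          · intro v
            rcases hs with q1 | q1 <;> rcases hh v with q2 | q2 <;> simp [q1, q2]
          · intro i j hij hb
            have := (R1 i j hij hb).1
            have hss : s * s = 1 := by rcases hs with q | q <;> simp [q]
            calc s * g i * S i j * (s * h j) = (s * s) * (g i * S i j * h j) := by ring
              _ = 1 := by rw [hss, this]; norm_num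
          · have : h b * h b = 1 := by rcases hhb with q | q <;> simp [q]
            show s * h b = _
            rw [hsdef, mul_assoc, this, mul_one]
          · have : g b * g b = 1 := by rcases hgb with q | q <;> simp [q]
            show s * g b = _
            rw [hc, mul_assoc, this, mul_one]
        · have hs : (g a * S a b) * g b = 1 ∨ (g a * S a b) * g b = -1 := by
            rcases hga with q1 | q1 <;> rcases h1 with q2 | q2 <;> rcases hgb with q3 | q3 <;>
              simp [q1, q2, q3]
          set s := (g a * S a b) * g b with hsdef
          refine ⟨fun v => - s * h v, fun v => s * g v, ?_, ?_, ?_, ?_, ?_⟩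
          · intro v
            rcases hs with q1 | q1 <;> rcases hh v with q2 | q2 <;> simp [q1, q2]
          · intro v
            rcases hs with q1 | q1 <;> rcases hg v with q2 | q2 <;> simp [q1, q2]
          · intro i j hij hb
            have := (R1 i j hij hb).2
            have hss : s * s = 1 := by rcases hs with q | q <;> simp [q]
            calc - s * h i * S i j * (s * g j) = - (s * s) * (h i * S i j * g j) := by ring
              _ = 1 := by rw [hss, this]; norm_num
          · have : g b * g b = 1 := by rcases hgb with q | q <;> simp [q]
            show s * g b = _
            rw [hsdef, mul_assoc, this, mul_one]
          · show - s * h b = _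
            rw [hsdef]
            clear_value s
            revert hc
            rcases hga with q1 | q1 <;> rcases h1 with q2 | q2 <;> rcases hgb with q3 | q3 <;>
              rcases hha with q4 | q4 <;> rcases hhb with q5 | q5 <;>
              simp only [q1, q2, q3, q4, q5] <;> norm_num
      obtain ⟨g', h', hg', hh', hgood', hb1, hb2⟩ := key
      refine ⟨fun v => if G'.Reachable b v then g' v else g v,
        fun v => if G'.Reachable b v then h' v else h v, ?_, ?_, B, ?_, ?_⟩
      · intro v
        dsimp only
        split_ifs
        · exact hg' v
        · exact hg v
      · intro v
        dsimp only
        split_ifs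
        · exact hh' v
        · exact hh v
      · have h1 := pc_comp1 G G' a b hcov
        unfold cycDim at hB ⊢
        rw [hn'] at hB
        rw [hn]
        push_cast
        omega
      · intro i j hij hnot
        have hra : ¬ G'.Reachable b a := fun q => hr q.symm
        have hsq : S a b * S a b = 1 := by rcases hS a b hab with q | q <;> simp [q]
        have hgq : g a * g a = 1 := by rcases hg a with q | q <;> simp [q]
        have hhq : h a * h a = 1 := by rcases hh a with q | q <;> simp [q]
        rcases hcov i j hij with q | q
        · by_cases hi : G'.Reachable b i
          · have hj : G'.Reachable b j := hi.trans q.reachable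
            simp only [if_pos hi, if_pos hj]
            exact hgood' i j q hnot
          · have hj : ¬ G'.Reachable b j := fun hj => hi (hj.trans q.symm.reachable)
            simp only [if_neg hi, if_neg hj]
            exact hgood i j q hnot
        · rcases Sym2.eq_iff.1 q with ⟨rfl, rfl⟩ | ⟨rfl, rfl⟩
          · simp only [if_neg hra, if_pos (SimpleGraph.Reachable.refl _), hb1]
            calc _ = (g i * g i) * (S i j * S i j) := by ring
              _ = 1 := by rw [hsq, hgq, one_mul]
          · simp only [if_neg hra, if_pos (SimpleGraph.Reachable.refl _), hb2]
            rw [hskew j i]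
            calc _ = (h j * h j) * (S j i * S j i) := by ring
              _ = 1 := by rw [hsq, hhq, one_mul]

theorem pc_lower [Fintype V] (G : SimpleGraph V) (S : Matrix V V ℝ) (hS : IsSkewAdjMatrix G S) :
    ((adjMat G).rank : ℤ) ≤ (S.rank : ℤ) + 2 * cycDim G := by
  obtain ⟨h1, h2, h3⟩ := hS
  obtain ⟨g, h, hg, hh, B, hB, hgood⟩ := pc_gauge S h3 _ G rfl h1
  set T : Matrix V V ℝ := Matrix.diagonal g * S * Matrix.diagonal h with hT
  have hTe : ∀ i j, T i j = g i * S i j * h j := by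
    intro i j
    rw [hT, Matrix.mul_diagonal, Matrix.diagonal_mul]
  have r1 : T.rank ≤ S.rank :=
    (Matrix.rank_mul_le_left _ _).trans (Matrix.rank_mul_le_right _ _)
  have r2 : (adjMat G - T).rank ≤ 2 * B.card := by
    apply pc_rank_bad
    intro i j hne
    by_contra hnot
    apply hne
    by_cases hij : G.Adj i j
    · simp [adjMat, hij, hTe, hgood i j hij hnot]
    · simp [adjMat, hij, hTe, h2 i j hij]
  have r3 := pc_rank_add_le T (adjMat G - T)
  rw [add_sub_cancel] at r3
  omega

end Gauge

section Counting

variable {V : Type*} [Fintype V]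

theorem pc_retract (G : SimpleGraph V) (s : Set V) (ρ : V → s)
    (h1 : ∀ v (hv : v ∈ s), ρ v = ⟨v, hv⟩) (h2 : ∀ v, G.Reachable v (ρ v))
    (h3 : ∀ i j, G.Adj i j → (G.induce s).Reachable (ρ i) (ρ j)) :
    Nat.card (G.induce s).ConnectedComponent = Nat.card G.ConnectedComponent := by
  apply le_antisymm
  · obtain ⟨φ, hφ⟩ := pc_lift G (fun v => (G.induce s).connectedComponentMk (ρ v))
      (fun i j hij => SimpleGraph.ConnectedComponent.sound (h3 i j hij))
    refine Nat.card_le_card_of_surjective φ ?_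
    intro c
    induction c using SimpleGraph.ConnectedComponent.ind with
    | _ v => exact ⟨G.connectedComponentMk v, by rw [hφ, h1 v v.2]⟩
  · obtain ⟨φ, hφ⟩ := pc_lift (G.induce s) (fun v => G.connectedComponentMk (v : V))
      (fun i j hij => SimpleGraph.ConnectedComponent.sound
        (SimpleGraph.Adj.reachable (SimpleGraph.induce_adj.1 hij)))
    refine Nat.card_le_card_of_surjective φ ?_
    intro c
    induction c using SimpleGraph.ConnectedComponent.ind with
    | _ v =>
      exact ⟨(G.induce s).connectedComponentMk (ρ v), by
        rw [hφ]; exact SimpleGraph.ConnectedComponent.sound (h2 v).symm⟩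

theorem pc_edges_induce (G : SimpleGraph V) (s : Set V) :
    (G.induce s).edgeSet.ncard = {e ∈ G.edgeSet | ∀ v ∈ e, v ∈ s}.ncard := by
  have : {e ∈ G.edgeSet | ∀ v ∈ e, v ∈ s} = Sym2.map (Subtype.val : s → V) '' (G.induce s).edgeSet := by
    ext e
    induction e using Sym2.ind with
    | _ a b =>
    constructor
    · rintro ⟨h1, h2⟩
      exact ⟨s(⟨a, h2 a (by simp)⟩, ⟨b, h2 b (by simp)⟩), h1, rfl⟩
    · rintro ⟨e', he', heq⟩
      induction e' using Sym2.ind with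
      | _ a' b' =>
      rw [Sym2.map_mk] at heq
      rw [← heq]
      refine ⟨he', ?_⟩
      intro v hv
      rw [Sym2.mem_iff] at hv
      rcases hv with rfl | rfl
      · exact a'.2
      · exact b'.2
  rw [this, Set.ncard_image_of_injective _ (Sym2.map.injective Subtype.val_injective)]

theorem pc_nbr (G : SimpleGraph V) (u x : V) (c : G.Walk u u) (hc : c.IsCycle) (hx : x ∈ c.support)
    (hind : ∀ a ∈ c.support, ∀ b ∈ c.support, G.Adj a b → s(a, b) ∈ c.edges)
    (hdegx : (G.neighborSet x).ncard = 3)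
    (hdeg : ∀ v ∈ c.support, v ≠ x → (G.neighborSet v).ncard = 2) :
    (∀ v ∈ c.support, v ≠ x → ∀ w, G.Adj v w → s(v, w) ∈ c.edges) ∧
    ∃ y, y ∉ c.support ∧ G.Adj x y ∧ ∀ w, G.Adj x w → w = y ∨ s(x, w) ∈ c.edges := by
  constructor
  · intro v hv hvx w hw
    have h2 := hc.ncard_neighborSet_toSubgraph_eq_two hv
    have heq : c.toSubgraph.neighborSet v = G.neighborSet v :=
      Set.eq_of_subset_of_ncard_le (c.toSubgraph.neighborSet_subset v)
        (by rw [h2, hdeg v hv hvx]) (Set.toFinite _)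
    have : w ∈ c.toSubgraph.neighborSet v := by rw [heq]; exact hw
    exact SimpleGraph.Walk.adj_toSubgraph_iff_mem_edges.1 this
  · have h2 := hc.ncard_neighborSet_toSubgraph_eq_two hx
    have h3 : (G.neighborSet x \ c.toSubgraph.neighborSet x).ncard = 1 := by
      rw [Set.ncard_diff (c.toSubgraph.neighborSet_subset x) (Set.toFinite _), h2, hdegx]
    obtain ⟨y, hy⟩ := Set.ncard_eq_one.1 h3
    have hy' : y ∈ G.neighborSet x \ c.toSubgraph.neighborSet x := by rw [hy]; rfl
    have hyadj : G.Adj x y := hy'.1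
    refine ⟨y, ?_, hyadj, ?_⟩
    · intro hys
      exact hy'.2 (SimpleGraph.Walk.adj_toSubgraph_iff_mem_edges.2 (hind x hx y hys hyadj))
    · intro w hw
      by_cases h : s(x, w) ∈ c.edges
      · exact Or.inr h
      · left
        have : w ∈ G.neighborSet x \ c.toSubgraph.neighborSet x :=
          ⟨hw, fun h' => h (SimpleGraph.Walk.adj_toSubgraph_iff_mem_edges.1 h')⟩
        rw [hy] at this
        exact this

theorem pc_cyc (G : SimpleGraph V) (u x : V) (c : G.Walk u u) (hc : c.IsCycle) (hx : x ∈ c.support)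
    (F1 : ∀ v ∈ c.support, v ≠ x → ∀ w, G.Adj v w → s(v, w) ∈ c.edges)
    (y : V) (hy : y ∉ c.support) (hxy : G.Adj x y)
    (F2 : ∀ w, G.Adj x w → w = y ∨ s(x, w) ∈ c.edges)
    (H K : Finset V) (hH : ∀ v, v ∈ H ↔ v ∉ c.support) (hK : ∀ v, v ∈ K ↔ v = x ∨ v ∉ c.support) :
    cycDim (G.induce (↑H : Set V)) = cycDim G - 1 ∧ cycDim (G.induce (↑K : Set V)) = cycDim G - 1 := by
  have hsup : ∀ a b, s(a, b) ∈ c.edges → a ∈ c.support ∧ b ∈ c.support := fun a b h =>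
    ⟨c.fst_mem_support_of_mem_edges h, c.snd_mem_support_of_mem_edges h⟩
  have hreach : ∀ v ∈ c.support, G.Reachable v x := fun v hv =>
    (SimpleGraph.Walk.reachable (c.takeUntil v hv)).symm.trans (c.takeUntil x hx).reachable
  have hyH : y ∈ (↑H : Set V) := (hH y).2 hy
  have hyK : y ∈ (↑K : Set V) := (hK y).2 (Or.inr hy)
  have hxK : x ∈ (↑K : Set V) := (hK x).2 (Or.inl rfl)
  have hxH : x ∉ H := fun h => (hH x).1 h hx
  -- components
  have cH : Nat.card (G.induce (↑H : Set V)).ConnectedComponent = Nat.card G.ConnectedComponent := by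
    apply pc_retract G ↑H (fun v => if hv : v ∈ (↑H : Set V) then ⟨v, hv⟩ else ⟨y, hyH⟩)
    · intro v hv
      rw [dif_pos hv]
    · intro v
      by_cases hv : v ∈ (↑H : Set V)
      · rw [dif_pos hv]
      · rw [dif_neg hv]
        have : v ∈ c.support := by
          by_contra h; exact hv ((hH v).2 h)
        exact (hreach v this).trans hxy.reachable
    · have main : ∀ i j, G.Adj i j → i ∉ (↑H : Set V) → j ∈ (↑H : Set V) → j = y := by
        intro i j hij hi hj
        have his : i ∈ c.support := by
          by_contra h; exact hi ((hH i).2 h)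
        have hjs : j ∉ c.support := (hH j).1 hj
        by_cases hix : i = x
        · subst hix
          rcases F2 j hij with h | h
          · exact h
          · exact absurd (hsup _ _ h).2 hjs
        · exact absurd (hsup _ _ (F1 i his hix j hij)).2 hjs
      intro i j hij
      by_cases hi : i ∈ (↑H : Set V) <;> by_cases hj : j ∈ (↑H : Set V)
      · rw [dif_pos hi, dif_pos hj]
        exact SimpleGraph.Adj.reachable (SimpleGraph.induce_adj.2 hij)
      · rw [dif_pos hi, dif_neg hj]
        have := main j i hij.symm hj hi
        subst this; rfl
      · rw [dif_neg hi, dif_pos hj]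
        have := main i j hij hi hj
        subst this; rfl
      · rw [dif_neg hi, dif_neg hj]
  have cK : Nat.card (G.induce (↑K : Set V)).ConnectedComponent = Nat.card G.ConnectedComponent := by
    apply pc_retract G ↑K (fun v => if hv : v ∈ (↑K : Set V) then ⟨v, hv⟩ else ⟨x, hxK⟩)
    · intro v hv
      rw [dif_pos hv]
    · intro v
      by_cases hv : v ∈ (↑K : Set V)
      · rw [dif_pos hv]
      · rw [dif_neg hv]
        have : v ∈ c.support := by
          by_contra h; exact hv ((hK v).2 (Or.inr h))
        exact hreach v this
    · have main : ∀ i j, G.Adj i j → i ∉ (↑K : Set V) → j ∈ (↑K : Set V) → j = x := by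
        intro i j hij hi hj
        have hi' : ¬ (i = x ∨ i ∉ c.support) := fun h => hi ((hK i).2 h)
        push Not at hi'
        have h := hsup _ _ (F1 i hi'.2 hi'.1 j hij)
        rcases (hK j).1 hj with h' | h'
        · exact h'
        · exact absurd h.2 h'
      intro i j hij
      by_cases hi : i ∈ (↑K : Set V) <;> by_cases hj : j ∈ (↑K : Set V)
      · rw [dif_pos hi, dif_pos hj]
        exact SimpleGraph.Adj.reachable (SimpleGraph.induce_adj.2 hij)
      · rw [dif_pos hi, dif_neg hj]
        have := main j i hij.symm hj hi
        subst this; rfl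
      · rw [dif_neg hi, dif_pos hj]
        have := main i j hij hi hj
        subst this; rfl
      · rw [dif_neg hi, dif_neg hj]
  -- vertices
  have vc : c.support.toFinset.card = c.length := by
    have h1 : c.support.toFinset = c.support.tail.toFinset := by
      ext v
      rw [List.mem_toFinset, List.mem_toFinset]
      constructor
      · intro hv
        rw [SimpleGraph.Walk.mem_support_iff] at hv
        rcases hv with rfl | hv
        · exact SimpleGraph.Walk.end_mem_tail_support (fun hn => hc.not_nil hn)
        · exact hv
      · exact fun hv => List.mem_of_mem_tail hv
    rw [h1, List.toFinset_card_of_nodup hc.support_nodup]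
    simp
  have vH : Nat.card (↑H : Set V) + c.length = Nat.card V := by
    rw [← vc, Nat.card_eq_fintype_card (α := V)]
    have : H = c.support.toFinsetᶜ := by
      ext v; rw [hH, Finset.mem_compl, List.mem_toFinset]
    have h2 : Nat.card (↑H : Set V) = H.card := by simp
    rw [h2, this, Finset.card_compl, Nat.sub_add_cancel (Finset.card_le_univ _)]
  have vK : Nat.card (↑K : Set V) = Nat.card (↑H : Set V) + 1 := by
    have : K = insert x H := by
      ext v; rw [hK, Finset.mem_insert, hH]
    have h2 : Nat.card (↑H : Set V) = H.card := by simp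
    have h3 : Nat.card (↑K : Set V) = K.card := by simp
    rw [h2, h3, this, Finset.card_insert_of_notMem hxH]
  -- edges
  have eK : (G.induce (↑K : Set V)).edgeSet.ncard = (G.induce (↑H : Set V)).edgeSet.ncard + 1 := by
    rw [pc_edges_induce, pc_edges_induce, ← Set.ncard_insert_of_notMem (a := s(x, y)) _ (Set.toFinite _)]
    · congr 1
      ext e
      induction e using Sym2.ind with
      | _ a b =>
      simp only [Set.mem_insert_iff, Set.mem_setOf_eq, SimpleGraph.mem_edgeSet, Sym2.mem_iff,
        forall_eq_or_imp, forall_eq, Finset.mem_coe, hH, hK]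
      constructor
      · rintro ⟨hab, ha, hb⟩
        by_cases hax : a = x
        · left
          subst hax
          rcases F2 b hab with h | h
          · rw [h]
          · rcases hb with hb | hb
            · exact absurd hb.symm hab.ne
            · exact absurd (hsup _ _ h).2 hb
        · by_cases hbx : b = x
          · left
            subst hbx
            rcases F2 a hab.symm with h | h
            · rw [h, Sym2.eq_swap]
            · rcases ha with ha | ha
              · exact absurd ha hab.ne
              · exact absurd (hsup _ _ h).2 ha
          · right
            exact ⟨hab, ha.resolve_left hax, hb.resolve_left hbx⟩
      · rintro (h | ⟨hab, ha, hb⟩)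
        · rcases Sym2.eq_iff.1 h with ⟨rfl, rfl⟩ | ⟨rfl, rfl⟩
          · exact ⟨hxy, Or.inl rfl, Or.inr hy⟩
          · exact ⟨hxy.symm, Or.inr hy, Or.inl rfl⟩
        · exact ⟨hab, Or.inr ha, Or.inr hb⟩
    · rintro ⟨_, h⟩
      exact hxH (h x (by simp))
  have eG : G.edgeSet.ncard = (G.induce (↑K : Set V)).edgeSet.ncard + c.length := by
    have hl : c.length = {e | e ∈ c.edges}.ncard := by
      rw [← c.length_edges, ← List.toFinset_card_of_nodup hc.isCircuit.isTrail.edges_nodup,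
        ← Set.ncard_coe_finset]
      congr 1
      ext e; simp
    rw [pc_edges_induce, hl, ← Set.ncard_union_eq _ (Set.toFinite _) (Set.toFinite _)]
    · congr 1
      ext e
      induction e using Sym2.ind with
      | _ a b =>
      simp only [Set.mem_union, Set.mem_setOf_eq, SimpleGraph.mem_edgeSet, Sym2.mem_iff,
        forall_eq_or_imp, forall_eq, Finset.mem_coe, hK]
      constructor
      · intro hab
        by_cases ha : a = x ∨ a ∉ c.support
        · by_cases hb : b = x ∨ b ∉ c.support
          · exact Or.inl ⟨hab, ha, hb⟩
          · push Not at hb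
            right
            rw [Sym2.eq_swap]
            exact F1 b hb.2 hb.1 a hab.symm
        · push Not at ha
          exact Or.inr (F1 a ha.2 ha.1 b hab)
      · rintro (h | h)
        · exact h.1
        · exact c.adj_of_mem_edges h
    · rw [Set.disjoint_left]
      intro e
      induction e using Sym2.ind with
      | _ a b =>
      simp only [Set.mem_setOf_eq, SimpleGraph.mem_edgeSet, Sym2.mem_iff,
        forall_eq_or_imp, forall_eq, Finset.mem_coe, hK]
      rintro ⟨hab, ha, hb⟩ h
      have := hsup _ _ h
      have h1 : a = x := ha.resolve_right (fun h => h this.1)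
      have h2 : b = x := hb.resolve_right (fun h => h this.2)
      exact hab.ne (h1.trans h2.symm)
  unfold cycDim
  rw [cH, cK]
  omega

end Counting

section Final

variable {V : Type*}

theorem pc_dart_prod (G : SimpleGraph V) (S : Matrix V V ℝ) : ∀ {u v : V} (c : G.Walk u v),
    (c.darts.map fun d => S d.toProd.1 d.toProd.2).prod
      = ∏ k ∈ Finset.range c.length, S (c.getVert k) (c.getVert (k + 1)) := by
  intro u v c
  induction c with
  | nil => simp
  | cons h p ih =>
    rw [SimpleGraph.Walk.length_cons, Finset.prod_range_succ']
    simp only [SimpleGraph.Walk.darts_cons, List.map_cons, List.prod_cons, ih,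
      SimpleGraph.Walk.getVert_cons_succ, SimpleGraph.Walk.getVert_zero]
    rw [mul_comm]

theorem pc_edges_eq (G : SimpleGraph V) : ∀ {u v : V} (c : G.Walk u v),
    c.edges = (List.range c.length).map (fun k => s(c.getVert k, c.getVert (k + 1))) := by
  intro u v c
  induction c with
  | nil => simp
  | cons h p ih =>
    rw [SimpleGraph.Walk.length_cons, List.range_succ_eq_map]
    simp only [SimpleGraph.Walk.edges_cons, ih, List.map_cons, List.map_map,
      SimpleGraph.Walk.getVert_cons_succ, SimpleGraph.Walk.getVert_zero]
    rfl

theorem pc_seq (G : SimpleGraph V) (u x : V) (c : G.Walk u u) (hc : c.IsCycle)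
    (hx : x ∈ c.support) :
    ∃ v : ℕ → V, v 0 = x ∧ v c.length = x ∧
      (∀ k, k < c.length → G.Adj (v k) (v (k + 1))) ∧
      (∀ k l, 1 ≤ k → k < c.length → l ≤ c.length → k ≠ l → v k ≠ v l) ∧
      (∀ e, e ∈ c.edges ↔ ∃ k, k < c.length ∧ s(v k, v (k + 1)) = e) ∧
      (∀ k l, k < c.length → l < c.length → s(v k, v (k + 1)) = s(v l, v (l + 1)) → k = l) ∧
      (∀ k, v k ∈ c.support) ∧
      (∀ S : Matrix V V ℝ, (c.darts.map fun d => S d.toProd.1 d.toProd.2).prod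
        = ∏ k ∈ Finset.range c.length, S (v k) (v (k + 1))) := by
  have hc' := hc.rotate hx
  have hlen : (c.rotate x hx).length = c.length := SimpleGraph.Walk.length_rotate _ _ _
  have hE := (c.rotate_edges x hx).perm
  have hD := (c.rotate_darts x hx).perm
  have hsup : ∀ w, w ∈ (c.rotate x hx).support ↔ w ∈ c.support := fun w =>
    SimpleGraph.Walk.mem_support_rotate_iff _ _ _
  generalize c.rotate x hx = c' at *
  have hinj := hc'.getVert_injOn
  have h3 := hc'.three_le_length
  rw [← hlen]
  refine ⟨c'.getVert, c'.getVert_zero, c'.getVert_length, fun k hk => c'.adj_getVert_succ hk, ?_, ?_, ?_,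
    fun k => (hsup _).1 (c'.getVert_mem_support k), ?_⟩
  · intro k l h1 h2 h3 hne heq
    rcases Nat.eq_zero_or_pos l with rfl | hl
    · rw [c'.getVert_zero] at heq
      have := hinj (show k ∈ {i | 1 ≤ i ∧ i ≤ c'.length} from ⟨h1, h2.le⟩)
        (show c'.length ∈ {i | 1 ≤ i ∧ i ≤ c'.length} from ⟨by omega, le_rfl⟩) 
        (heq.trans c'.getVert_length.symm)
      omega
    · exact hne (hinj ⟨h1, h2.le⟩ ⟨hl, h3⟩ heq)
  · intro e
    rw [← hE.mem_iff, pc_edges_eq]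
    simp
  · intro k l hk hl heq
    have hn := hc'.isCircuit.isTrail.edges_nodup
    rw [pc_edges_eq] at hn
    exact List.inj_on_of_nodup_map hn (List.mem_range.2 hk) (List.mem_range.2 hl) heq
  · intro S
    rw [← pc_dart_prod]
    exact ((hD.map _).prod_eq).symm

theorem pc_decomp [Fintype V] (ε : ℝ) (M : Matrix V V ℝ) (hM : ∀ i j, M j i = ε * M i j)
    (v : ℕ → V) (q : ℕ) (P : V → Prop)
    (h1 : ∀ k, k < q → v k ≠ v (k + 1))
    (h2 : ∀ k l, k < q → l < q → s(v k, v (k + 1)) = s(v l, v (l + 1)) → k = l)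
    (h3 : ∀ i j, P i → P j → ∀ k, k < q → s(v k, v (k + 1)) ≠ s(i, j))
    (h4 : ∀ i j, M i j ≠ 0 → (P i ∧ P j) ∨ ∃ k, k < q ∧ s(v k, v (k + 1)) = s(i, j)) :
    M = pcRes M P + ∑ k ∈ Finset.range q, pcN ε (v k) (v (k + 1)) (M (v k) (v (k + 1))) := by
  have hN : ∀ k, k < q → ∀ i j, pcN ε (v k) (v (k + 1)) (M (v k) (v (k + 1))) i j
      = if s(v k, v (k + 1)) = s(i, j) then M i j else 0 := by
    intro k hk i j
    have hne := h1 k hk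
    simp only [pcN, Matrix.of_apply, Sym2.eq_iff]
    by_cases ha : v k = i ∧ v (k + 1) = j
    · obtain ⟨rfl, rfl⟩ := ha
      simp [hne]
    · by_cases hb : v k = j ∧ v (k + 1) = i
      · obtain ⟨rfl, rfl⟩ := hb
        simp [hne, hne.symm, hM (v k) (v (k + 1))]
      · rw [if_neg (fun h => ha ⟨h.1.symm, h.2.symm⟩), if_neg (fun h => hb ⟨h.2.symm, h.1.symm⟩),
          if_neg (not_or.2 ⟨ha, hb⟩), add_zero]
  ext i j
  rw [Matrix.add_apply, Matrix.sum_apply,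
    Finset.sum_congr rfl (fun k hk => hN k (Finset.mem_range.1 hk) i j)]
  by_cases he : ∃ k, k < q ∧ s(v k, v (k + 1)) = s(i, j)
  · obtain ⟨k, hk, hke⟩ := he
    rw [Finset.sum_eq_single k, if_pos hke]
    · have : ¬ (P i ∧ P j) := fun h => h3 i j h.1 h.2 k hk hke
      simp [pcRes, this]
    · intro l hl hlk
      rw [if_neg]
      intro h
      exact hlk (h2 l k (Finset.mem_range.1 hl) hk (h.trans hke.symm))
    · intro h; exact absurd (Finset.mem_range.2 hk) h
  · rw [Finset.sum_eq_zero]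
    · by_cases hP : P i ∧ P j
      · simp [pcRes, hP]
      · have : M i j = 0 := by
          by_contra h
          rcases h4 i j h with h | h
          · exact hP h
          · exact he h
        simp [pcRes, hP, this]
    · intro k hk
      rw [if_neg]
      intro h
      exact he ⟨k, Finset.mem_range.1 hk, h⟩

theorem pc_even [Fintype V] (ε : ℝ) (hε : ε * ε = 1) (C : Matrix V V ℝ) (v : ℕ → V) (a : ℕ → ℝ)
    (t : ℕ) (x : V) (h0 : v 0 = x) (hq : v (2 * t + 2) = x)
    (ha : ∀ k, k < 2 * t + 2 → a k * a k = 1)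
    (hv : ∀ k l, 1 ≤ k → k < 2 * t + 2 → l ≤ 2 * t + 2 → k ≠ l → v k ≠ v l)
    (hC : ∀ k, 1 ≤ k → k < 2 * t + 2 → ∀ j, C (v k) j = 0 ∧ C j (v k) = 0) :
    (C + ∑ k ∈ Finset.range (2 * t + 2), pcN ε (v k) (v (k + 1)) (a k)).rank
      = 2 * t + (C + pcN ε x (v (2 * t + 1))
        ((-ε) ^ t * (∏ k ∈ Finset.range (2 * t + 1), a k) + ε * a (2 * t + 1))).rank := by
  rw [Finset.sum_range_succ, add_comm (∑ k ∈ Finset.range (2 * t + 1), _), ← add_assoc,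
    pc_path ε hε v a t]
  · have e : v (2 * t + 1 + 1) = x := hq
    rw [e, h0, add_assoc, pcN_swap ε hε (v (2 * t + 1)) x, pcN_add, add_comm (ε * _)]
  · intro k hk; exact ha k (by omega)
  · intro k l h1 h2 h3 h4; exact hv k l h1 (by omega) (by omega) h4
  · intro k h1 h2 j
    have hh := hC k h1 (by omega) j
    have n1 := hv k (2 * t + 1) h1 (by omega) (by omega) (by omega)
    have n2 := hv k (2 * t + 1 + 1) h1 (by omega) (by omega) (by omega)
    rw [Matrix.add_apply, Matrix.add_apply, hh.1, hh.2, pcN_row _ _ _ _ _ n1 n2,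
      pcN_col _ _ _ _ _ n1 n2]
    simp

/-- Summary of the rank computation for a weighted pendant cycle. -/
theorem pc_even' [Fintype V] (ε : ℝ) (hε : ε * ε = 1) (C : Matrix V V ℝ) (v : ℕ → V) (a : ℕ → ℝ)
    (t : ℕ) (x : V) (h0 : v 0 = x) (hq : v (2 * t + 2) = x)
    (ha : ∀ k, k < 2 * t + 2 → a k * a k = 1)
    (hv : ∀ k l, 1 ≤ k → k < 2 * t + 2 → l ≤ 2 * t + 2 → k ≠ l → v k ≠ v l)
    (hC : ∀ k, 1 ≤ k → k < 2 * t + 2 → ∀ j, C (v k) j = 0 ∧ C j (v k) = 0) (hxx : C x x = 0)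
    (w : ℝ) (hw : w = (-ε) ^ t * (∏ k ∈ Finset.range (2 * t + 1), a k) + ε * a (2 * t + 1)) :
    (w = 0 → (C + ∑ k ∈ Finset.range (2 * t + 2), pcN ε (v k) (v (k + 1)) (a k)).rank
      = 2 * t + C.rank) ∧
    (w ≠ 0 → (C + ∑ k ∈ Finset.range (2 * t + 2), pcN ε (v k) (v (k + 1)) (a k)).rank
      = 2 * t + 2 + (pcRes C (fun i => i ≠ x)).rank) := by
  rw [pc_even ε hε C v a t x h0 hq ha hv hC, ← hw]
  constructor
  · intro h; rw [h, pcN_zero, add_zero]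
  · intro h
    have n : x ≠ v (2 * t + 1) := by
      rw [← h0]
      exact (hv (2 * t + 1) 0 (by omega) (by omega) (by omega) (by omega)).symm
    rw [pc_pendant ε hε C x (v (2 * t + 1)) w h n
      (fun j => (hC _ (by omega) (by omega) j).1) (fun j => (hC _ (by omega) (by omega) j).2) hxx]
    ring

theorem pc_res_le [Fintype V] (M : Matrix V V ℝ) (s t : Finset V) (h : s ⊆ t) :
    (M.submatrix (fun w : s => (w : V)) (fun w : s => (w : V))).rank ≤
    (M.submatrix (fun w : t => (w : V)) (fun w : t => (w : V))).rank := by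
  have : M.submatrix (fun w : s => (w : V)) (fun w : s => (w : V))
      = (M.submatrix (fun w : t => (w : V)) (fun w : t => (w : V))).submatrix
        (fun w : s => (⟨w, h w.2⟩ : t)) (fun w : s => (⟨w, h w.2⟩ : t)) := rfl
  rw [this]
  exact Matrix.rank_submatrix_le _ _ _

theorem pc_res_res [Fintype V] (M : Matrix V V ℝ) (x : V) (H K : Finset V)
    (hHK : ∀ v, v ∈ H ↔ v ∈ K ∧ v ≠ x) :
    pcRes (pcRes M (fun i => i ∈ K)) (fun i => i ≠ x) = pcRes M (fun i => i ∈ H) := by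
  ext i j
  simp only [pcRes, Matrix.of_apply, hHK]
  split_ifs <;> tauto

theorem pc_induce_skew (G : SimpleGraph V) (S : Matrix V V ℝ) (hS : IsSkewAdjMatrix G S)
    (s : Finset V) : IsSkewAdjMatrix (G.induce (↑s : Set V))
      (S.submatrix (fun w : s => (w : V)) (fun w : s => (w : V))) :=
  ⟨fun i j h => hS.1 _ _ h, fun i j h => hS.2.1 _ _ h, fun i j => hS.2.2 _ _⟩

theorem pc_lower_sub [Fintype V] (G : SimpleGraph V) (S : Matrix V V ℝ) (hS : IsSkewAdjMatrix G S)
    (s : Finset V) :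
    (((adjMat G).submatrix (fun w : s => (w : V)) (fun w : s => (w : V))).rank : ℤ) ≤
    ((S.submatrix (fun w : s => (w : V)) (fun w : s => (w : V))).rank : ℤ)
      + 2 * cycDim (G.induce (↑s : Set V)) := by
  have h := pc_lower (V := s) (G.induce (↑s : Set V)) _ (pc_induce_skew G S hS s)
  have e : (adjMat G).submatrix (fun w : s => (w : V)) (fun w : s => (w : V))
      = adjMat (G.induce (↑s : Set V)) := by
    ext i j
    simp only [adjMat, Matrix.submatrix_apply, Matrix.of_apply, SimpleGraph.induce_adj]
  rw [e]
  exact h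

theorem pc_main [Fintype V] (G : SimpleGraph V) (S : Matrix V V ℝ) (hS : IsSkewAdjMatrix G S)
    (hlo : (S.rank : ℤ) = ((adjMat G).rank : ℤ) - 2 * cycDim G)
    (u x : V) (c : G.Walk u u) (hc : c.IsCycle) (hx : x ∈ c.support)
    (hind : ∀ a ∈ c.support, ∀ b ∈ c.support, G.Adj a b → s(a, b) ∈ c.edges)
    (hdegx : (G.neighborSet x).ncard = 3)
    (hdeg : ∀ v ∈ c.support, v ≠ x → (G.neighborSet v).ncard = 2)
    (H K : Finset V) (hH : ∀ v, v ∈ H ↔ v ∉ c.support)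
    (hK : ∀ v, v ∈ K ↔ v = x ∨ v ∉ c.support) :
    c.length % 4 = 2 ∧
    0 < (c.darts.map fun d => S d.toProd.1 d.toProd.2).prod ∧
    (S.rank : ℤ) = (c.length : ℤ) - 2 +
      (S.submatrix (fun w : K => (w : V)) (fun w : K => (w : V))).rank ∧
    (S.submatrix (fun w : H => (w : V)) (fun w : H => (w : V))).rank =
      (S.submatrix (fun w : K => (w : V)) (fun w : K => (w : V))).rank ∧
    ((adjMat G).rank : ℤ) = (c.length : ℤ) +
      ((adjMat G).submatrix (fun w : K => (w : V)) (fun w : K => (w : V))).rank ∧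
    ((adjMat G).submatrix (fun w : H => (w : V)) (fun w : H => (w : V))).rank =
      ((adjMat G).submatrix (fun w : K => (w : V)) (fun w : K => (w : V))).rank ∧
    (((S.submatrix (fun w : H => (w : V)) (fun w : H => (w : V))).rank : ℤ) =
      (((adjMat G).submatrix (fun w : H => (w : V)) (fun w : H => (w : V))).rank : ℤ) -
      2 * cycDim (G.induce (↑H : Set V))) ∧
    (((S.submatrix (fun w : K => (w : V)) (fun w : K => (w : V))).rank : ℤ) =
      (((adjMat G).submatrix (fun w : K => (w : V)) (fun w : K => (w : V))).rank : ℤ) -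
      2 * cycDim (G.induce (↑K : Set V))) := by
  obtain ⟨F1, y, hy, hxy, F2⟩ := pc_nbr G u x c hc hx hind hdegx hdeg
  obtain ⟨dH, dK⟩ := pc_cyc G u x c hc hx F1 y hy hxy F2 H K hH hK
  have lH := pc_lower_sub G S hS H
  have lK := pc_lower_sub G S hS K
  have hHK : ∀ v, v ∈ H ↔ v ∈ K ∧ v ≠ x := by
    intro v
    rw [hH, hK]
    constructor
    · intro h
      exact ⟨Or.inr h, fun e => h (e ▸ hx)⟩
    · rintro ⟨h1, h2⟩
      exact h1.resolve_left h2
  have hsub : H ⊆ K := fun v hv => ((hHK v).1 hv).1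
  have mS := pc_res_le S H K hsub
  have mA := pc_res_le (adjMat G) H K hsub
  have vS : (S.submatrix (fun w : K => (w : V)) (fun w : K => (w : V))).rank ≤
      (S.submatrix (fun w : H => (w : V)) (fun w : H => (w : V))).rank + 2 := by
    rw [pc_rank_res, pc_rank_res, ← pc_res_res S x H K hHK]
    exact pc_rank_res_vertex _ x
  have hq3 := hc.three_le_length
  obtain ⟨v, v0, vq, vadj, vinj, vedge, veinj, vsup, vprod⟩ := pc_seq G u x c hc hx
  rw [vprod]
  -- decompositions
  have hvK : ∀ k, 1 ≤ k → k < c.length → v k ∉ K := by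
    intro k h1 h2 h
    rcases (hK _).1 h with h | h
    · exact vinj k 0 h1 h2 (by omega) (by omega) (h.trans v0.symm)
    · exact h (vsup k)
  have h3 : ∀ i j, i ∈ K → j ∈ K → ∀ k, k < c.length → s(v k, v (k + 1)) ≠ s(i, j) := by
    intro i j hi hj k hk he
    rcases Nat.eq_zero_or_pos k with rfl | hk0
    · have hn := hvK 1 le_rfl (by omega)
      rcases Sym2.eq_iff.1 he with ⟨_, h⟩ | ⟨_, h⟩
      · exact hn (h ▸ hj)
      · exact hn (h ▸ hi)
    · have hn := hvK k hk0 hk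
      rcases Sym2.eq_iff.1 he with ⟨h, _⟩ | ⟨h, _⟩
      · exact hn (h ▸ hi)
      · exact hn (h ▸ hj)
  have h4 : ∀ i j, G.Adj i j → (i ∈ K ∧ j ∈ K) ∨ ∃ k, k < c.length ∧ s(v k, v (k + 1)) = s(i, j) := by
    intro i j hij
    rw [← vedge, hK, hK]
    by_cases ha : i = x ∨ i ∉ c.support
    · by_cases hb : j = x ∨ j ∉ c.support
      · exact Or.inl ⟨ha, hb⟩
      · push Not at hb
        right
        rw [Sym2.eq_swap]
        exact F1 j hb.2 hb.1 i hij.symm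
    · push Not at ha
      exact Or.inr (F1 i ha.2 ha.1 j hij)
  have decS := pc_decomp (-1) S (fun i j => by rw [hS.2.2 i j]; ring) v c.length (fun i => i ∈ K)
    (fun k hk => (vadj k hk).ne) veinj h3 (fun i j h => h4 i j (by
      by_contra hn; exact h (hS.2.1 i j hn)))
  have decA := pc_decomp 1 (adjMat G) (fun i j => by simp [adjMat, G.adj_comm]) v c.length
    (fun i => i ∈ K)
    (fun k hk => (vadj k hk).ne) veinj h3 (fun i j h => h4 i j (by
      by_contra hn; exact h (by simp [adjMat, hn])))
  have hCz : ∀ M : Matrix V V ℝ, ∀ k, 1 ≤ k → k < c.length → ∀ j,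
      pcRes M (fun i => i ∈ K) (v k) j = 0 ∧ pcRes M (fun i => i ∈ K) j (v k) = 0 := by
    intro M k h1 h2 j
    have := hvK k h1 h2
    simp [pcRes, this]
  have haS : ∀ k, k < c.length → S (v k) (v (k + 1)) * S (v k) (v (k + 1)) = 1 := by
    intro k hk
    rcases hS.1 _ _ (vadj k hk) with h | h <;> rw [h] <;> norm_num
  have haA : ∀ k, k < c.length → adjMat G (v k) (v (k + 1)) = 1 := by
    intro k hk
    simp [adjMat, vadj k hk]
  have sxx : pcRes S (fun i => i ∈ K) x x = 0 := by
    simp [pcRes, hS.2.1 x x G.irrefl]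
  have axx : pcRes (adjMat G) (fun i => i ∈ K) x x = 0 := by
    simp [pcRes, adjMat]
  have kS := pc_rank_res S K
  have kA := pc_rank_res (adjMat G) K
  have gS := pc_rank_res S H
  have gA := pc_rank_res (adjMat G) H
  rw [← pc_res_res S x H K hHK] at gS
  rw [← pc_res_res (adjMat G) x H K hHK] at gA
  generalize c.length = q at *
  have hpar : (∃ t, q = 2 * t + 2) ∨ ∃ t, q = 2 * t + 1 := by
    rcases Nat.even_or_odd' q with ⟨t, h | h⟩
    · exact Or.inl ⟨t - 1, by omega⟩
    · exact Or.inr ⟨t, h⟩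
  rcases hpar with ⟨t, rfl⟩ | ⟨t', rfl⟩
  · obtain ⟨S1, S2⟩ := pc_even' (-1) (by norm_num) (pcRes S (fun i => i ∈ K)) v
      (fun k => S (v k) (v (k + 1))) t x v0 vq haS vinj (hCz S) sxx _ rfl
    obtain ⟨A1, A2⟩ := pc_even' 1 (by norm_num) (pcRes (adjMat G) (fun i => i ∈ K)) v
      (fun k => adjMat G (v k) (v (k + 1))) t x v0 vq (fun k hk => by rw [haA k hk]; norm_num)
      vinj (hCz _) axx _ rfl
    rw [← decS] at S1 S2
    rw [← decA] at A1 A2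
    rw [Finset.prod_congr rfl (fun k hk => haA k (by have := Finset.mem_range.1 hk; omega)),
      haA (2 * t + 1) (by omega)] at A1 A2
    rw [← kS] at S1
    rw [← gS] at S2
    rw [← kA] at A1
    rw [← gA] at A2
    simp only [Finset.prod_const_one, mul_one, neg_neg, one_pow, one_mul] at A1 A2 S1 S2
    rcases Nat.even_or_odd t with ht | ht
    · have A := A2 (by rw [ht.neg_one_pow]; norm_num)
      by_cases hw : (∏ k ∈ Finset.range (2 * t + 1), S (v k) (v (k + 1)))
          + -1 * S (v (2 * t + 1)) (v (2 * t + 1 + 1)) = 0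
      · have B := S1 hw
        refine ⟨?_, ?_, ?_⟩
        · obtain ⟨r, hr⟩ := ht; omega
        · rw [Finset.prod_range_succ]
          have e : (∏ k ∈ Finset.range (2 * t + 1), S (v k) (v (k + 1)))
              = S (v (2 * t + 1)) (v (2 * t + 1 + 1)) := by linarith
          rw [e, haS (2 * t + 1) (by omega)]
          norm_num
        · push_cast
          omega
      · have B := S2 hw
        omega
    · have A := A1 (by rw [ht.neg_one_pow]; norm_num)
      by_cases hw : (∏ k ∈ Finset.range (2 * t + 1), S (v k) (v (k + 1)))
          + -1 * S (v (2 * t + 1)) (v (2 * t + 1 + 1)) = 0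
      · have B := S1 hw
        omega
      · have B := S2 hw
        omega
  · exfalso
    have P1 := pc_path (-1) (by norm_num) v (fun k => S (v k) (v (k + 1))) t'
      (pcRes S (fun i => i ∈ K)) (fun k hk => haS k (by omega))
      (fun k l h1 h2 h3 h4 => vinj k l h1 (by omega) h3 h4)
      (fun k h1 h2 => hCz S k h1 (by omega))
    have P2 := pc_path 1 (by norm_num) v (fun k => adjMat G (v k) (v (k + 1))) t'
      (pcRes (adjMat G) (fun i => i ∈ K)) (fun k hk => by rw [haA k (by omega)]; norm_num)
      (fun k l h1 h2 h3 h4 => vinj k l h1 (by omega) h3 h4)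
      (fun k h1 h2 => hCz _ k h1 (by omega))
    rw [← decS, v0, vq, pcN_loop_skew, add_zero, ← kS] at P1
    rw [← decA, v0, vq] at P2
    have L := pc_rank_loop (pcRes (adjMat G) (fun i => i ∈ K)) 1
      ((-1) ^ t' * ∏ k ∈ Finset.range (2 * t' + 1), adjMat G (v k) (v (k + 1))) x
    rw [← kA] at L
    omega

end Final

/-- Theorem 4.3: Let C_q^σ be a pendant oriented cycle of a lower-optimal
oriented graph G^σ, with x the unique vertex of C_q of degree 3 in G,
H^σ = G^σ - C_q^σ and K^σ = H^σ + x. Then q ≡ 2 (mod 4), C_q^σ is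
evenly-oriented, sr(G^σ) = q - 2 + sr(K^σ), sr(H^σ) = sr(K^σ),
r(G) = q + r(K), r(H) = r(K), and both H^σ and K^σ are lower-optimal.
The pendant cycle is given as a cycle walk c which is an induced subgraph,
all of whose vertices have degree 2 in G except x, which has degree 3. -/
theorem pendant_cycle_lowerOptimal {V : Type*} [Fintype V] [DecidableEq V]
    (G : SimpleGraph V) (S : Matrix V V ℝ) (hS : IsSkewAdjMatrix G S)
    (hlo : (S.rank : ℤ) = ((adjMat G).rank : ℤ) - 2 * cycDim G)
    (u x : V) (c : G.Walk u u) (hc : c.IsCycle) (hx : x ∈ c.support)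
    (hind : ∀ a ∈ c.support, ∀ b ∈ c.support, G.Adj a b → s(a, b) ∈ c.edges)
    (hdegx : (G.neighborSet x).ncard = 3)
    (hdeg : ∀ v ∈ c.support, v ≠ x → (G.neighborSet v).ncard = 2) :
    c.length % 4 = 2 ∧
    0 < (c.darts.map fun d => S d.toProd.1 d.toProd.2).prod ∧
    (S.rank : ℤ) = (c.length : ℤ) - 2 +
      (S.submatrix
        (fun w : (insert x c.support.toFinsetᶜ : Finset V) => (w : V))
        (fun w : (insert x c.support.toFinsetᶜ : Finset V) => (w : V))).rank ∧
    (S.submatrix (fun w : (c.support.toFinsetᶜ : Finset V) => (w : V))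
        (fun w : (c.support.toFinsetᶜ : Finset V) => (w : V))).rank =
      (S.submatrix
        (fun w : (insert x c.support.toFinsetᶜ : Finset V) => (w : V))
        (fun w : (insert x c.support.toFinsetᶜ : Finset V) => (w : V))).rank ∧
    ((adjMat G).rank : ℤ) = (c.length : ℤ) +
      ((adjMat G).submatrix
        (fun w : (insert x c.support.toFinsetᶜ : Finset V) => (w : V))
        (fun w : (insert x c.support.toFinsetᶜ : Finset V) => (w : V))).rank ∧
    ((adjMat G).submatrix (fun w : (c.support.toFinsetᶜ : Finset V) => (w : V))
        (fun w : (c.support.toFinsetᶜ : Finset V) => (w : V))).rank =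
      ((adjMat G).submatrix
        (fun w : (insert x c.support.toFinsetᶜ : Finset V) => (w : V))
        (fun w : (insert x c.support.toFinsetᶜ : Finset V) => (w : V))).rank ∧
    (((S.submatrix (fun w : (c.support.toFinsetᶜ : Finset V) => (w : V))
        (fun w : (c.support.toFinsetᶜ : Finset V) => (w : V))).rank : ℤ) =
      (((adjMat G).submatrix (fun w : (c.support.toFinsetᶜ : Finset V) => (w : V))
        (fun w : (c.support.toFinsetᶜ : Finset V) => (w : V))).rank : ℤ) -
      2 * cycDim (G.induce (↑(c.support.toFinsetᶜ : Finset V) : Set V))) ∧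
    (((S.submatrix
        (fun w : (insert x c.support.toFinsetᶜ : Finset V) => (w : V))
        (fun w : (insert x c.support.toFinsetᶜ : Finset V) => (w : V))).rank : ℤ) =
      (((adjMat G).submatrix
        (fun w : (insert x c.support.toFinsetᶜ : Finset V) => (w : V))
        (fun w : (insert x c.support.toFinsetᶜ : Finset V) => (w : V))).rank : ℤ) -
      2 * cycDim (G.induce (↑(insert x c.support.toFinsetᶜ : Finset V) : Set V))) := by
  exact pc_main G S hS hlo u x c hc hx hind hdegx hdeg _ _
    (fun v => by simp) (fun v => by simp)
end
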